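/- arXiv:2505.14678 — 4 statements merged into one kernel-verified Lean document; each statement's English description precedes it below -/
import Mathlib

section
/- Let a < b be real numbers and let γ = (γ₁,γ₂,γ₃,γ₄) : [a,b] → ℝ⁴ be a horizontal curve in the Engel group. Then there exists a C¹ horizontal curve Γ : [a,b] → ℝ⁴ in the Engel group such that the set {t ∈ [a,b] : Γ(t) = γ(t)} has strictly positive Lebesgue measure. -/
open MeasureTheory Set

/-- A function `f : ℝ → ℝ` is absolutely continuous on `[a,b]`:
it is the integral of an (interval) integrable function. -/
def AbsCont (f : ℝ → ℝ) (a b : ℝ) : Prop :=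
  ∃ g : ℝ → ℝ, IntervalIntegrable g volume a b ∧
    ∀ t ∈ Icc a b, f t = f a + ∫ s in a..t, g s

/-- A horizontal curve in the Engel group, identified with `ℝ⁴` in exponential
coordinates of the second kind: each component is absolutely continuous on `[a,b]`
and a.e. `γ₃' = γ₁ γ₂'` and `γ₄' = (1/2) γ₁² γ₂'`. -/
def HorizontalEngel (γ : ℝ → Fin 4 → ℝ) (a b : ℝ) : Prop :=
  (∀ i, AbsCont (fun t => γ t i) a b) ∧
  ∀ᵐ t ∂(volume.restrict (Icc a b)),
    (∀ i, DifferentiableAt ℝ (fun s => γ s i) t) ∧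
    deriv (fun s => γ s 2) t = γ t 0 * deriv (fun s => γ s 1) t ∧
    deriv (fun s => γ s 3) t = (1/2) * (γ t 0)^2 * deriv (fun s => γ s 1) t

/-- A `C¹` horizontal curve in the Engel group on `[a,b]`. -/
def C1HorizontalEngel (Γ : ℝ → Fin 4 → ℝ) (a b : ℝ) : Prop :=
  (∀ i, ContDiffOn ℝ 1 (fun t => Γ t i) (Icc a b)) ∧
  ∀ t ∈ Icc a b,
    derivWithin (fun s => Γ s 2) (Icc a b) t
      = Γ t 0 * derivWithin (fun s => Γ s 1) (Icc a b) t ∧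
    derivWithin (fun s => Γ s 3) (Icc a b) t
      = (1/2) * (Γ t 0)^2 * derivWithin (fun s => Γ s 1) (Icc a b) t

open Filter Topology

/-- Pairs of points `c < d` of `K` converging to `(s, s)`. -/
def pairFilter (K : Set ℝ) (s : ℝ) : Filter (ℝ × ℝ) :=
  𝓝 (s, s) ⊓ 𝓟 {p | p.1 ∈ K ∧ p.2 ∈ K ∧ p.1 < p.2}

/-- `(c, d)` is a bounded connected component of the complement of `K`. -/
def IsGap (K : Set ℝ) (c d : ℝ) : Prop :=
  c ∈ K ∧ d ∈ K ∧ c < d ∧ ∀ x ∈ K, ¬(c < x ∧ x < d)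

theorem eventually_pairFilter_iff {K : Set ℝ} {s : ℝ} {P : ℝ × ℝ → Prop} :
    (∀ᶠ p in pairFilter K s, P p) ↔ ∃ δ > 0, ∀ c ∈ K, ∀ d ∈ K, c < d → |c - s| < δ →
      |d - s| < δ → P (c, d) := by
  rw [pairFilter, eventually_inf_principal, Metric.eventually_nhds_iff]
  simp only [Prod.forall, Prod.dist_eq, sup_lt_iff, Real.dist_eq, mem_ofPred_eq]
  constructor
  · rintro ⟨δ, hδ, h⟩
    exact ⟨δ, hδ, fun c hc d hd hcd h1 h2 => h c d ⟨h1, h2⟩ ⟨hc, hd, hcd⟩⟩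
  · rintro ⟨δ, hδ, h⟩
    exact ⟨δ, hδ, fun c d h1 h2 => h c h2.1 d h2.2.1 h2.2.2 h1.1 h1.2⟩

theorem tendsto_fst_pairFilter (K : Set ℝ) (s : ℝ) :
    Tendsto Prod.fst (pairFilter K s) (𝓝[K] s) := by
  refine tendsto_nhdsWithin_iff.2 ⟨?_, ?_⟩
  · exact (continuous_fst.tendsto (s, s)).mono_left inf_le_left
  · exact eventually_inf_principal.2 (Eventually.of_forall fun p hp => hp.1)

theorem tendsto_snd_pairFilter (K : Set ℝ) (s : ℝ) :
    Tendsto Prod.snd (pairFilter K s) (𝓝[K] s) := by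
  refine tendsto_nhdsWithin_iff.2 ⟨?_, ?_⟩
  · exact (continuous_snd.tendsto (s, s)).mono_left inf_le_left
  · exact eventually_inf_principal.2 (Eventually.of_forall fun p hp => hp.2.1)

theorem tendsto_sub_pairFilter (K : Set ℝ) (s : ℝ) :
    Tendsto (fun p : ℝ × ℝ => p.2 - p.1) (pairFilter K s) (𝓝[>] 0) := by
  refine tendsto_nhdsWithin_iff.2 ⟨?_, ?_⟩
  · have h : Continuous fun p : ℝ × ℝ => p.2 - p.1 := by fun_prop
    simpa [pairFilter] using (h.tendsto (s, s)).mono_left inf_le_left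
  · exact eventually_inf_principal.2 (Eventually.of_forall fun p hp => sub_pos.2 hp.2.2)

theorem pairFilter_mono {K L : Set ℝ} (h : K ⊆ L) (s : ℝ) : pairFilter K s ≤ pairFilter L s :=
  inf_le_inf_left _ (principal_mono.2 fun _ hp => ⟨h hp.1, h hp.2.1, hp.2.2⟩)

theorem TendstoUniformlyOn.tendsto_pairFilter {E : Type*} [MetricSpace E] {R : ℝ → ℝ → E}
    {l : ℝ → E} {K : Set ℝ} (hR : TendstoUniformlyOn (fun h t => R t h) l (𝓝[>] 0) K)
    (hl : ContinuousOn l K) {s : ℝ} (hs : s ∈ K) :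
    Tendsto (fun p : ℝ × ℝ => R p.1 (p.2 - p.1)) (pairFilter K s) (𝓝 (l s)) := by
  rw [Metric.tendsto_nhds]
  intro ε hε
  have h1 := (tendsto_sub_pairFilter K s).eventually
    (Metric.tendstoUniformlyOn_iff.1 hR (ε / 2) (half_pos hε))
  have h2 := ((hl s hs).tendsto.comp (tendsto_fst_pairFilter K s)).eventually
    (Metric.ball_mem_nhds _ (half_pos hε))
  have h3 := (tendsto_nhdsWithin_iff.1 (tendsto_fst_pairFilter K s)).2
  filter_upwards [h1, h2, h3] with p h1 h2 h3
  have h4 := h1 p.1 h3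
  rw [dist_comm] at h4
  have h5 : dist (l p.1) (l s) < ε / 2 := h2
  linarith [dist_triangle (R p.1 (p.2 - p.1)) (l p.1) (l s)]

/-- An Egorov-type theorem: if `R t h → l t` as `h → 0⁺` for `t` in a set of positive measure and
`R` is continuous in `t`, the convergence is uniform on a compact set of positive measure. -/
theorem exists_isCompact_tendstoUniformlyOn {E : Type*} [MetricSpace E] {R : ℝ → ℝ → E}
    {l : ℝ → E} (hR : ∀ h > 0, Continuous fun t => R t h) {S : Set ℝ} (hS : MeasurableSet S)
    (hpos : 0 < volume S) (hfin : volume S ≠ ⊤)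
    (hlim : ∀ t ∈ S, Tendsto (R t) (𝓝[>] 0) (𝓝 (l t))) :
    ∃ K ⊆ S, IsCompact K ∧ 0 < volume K ∧ ContinuousOn l K ∧
      TendstoUniformlyOn (fun h t => R t h) l (𝓝[>] 0) K := by
  let A : ℕ → ℕ → Set ℝ := fun m n => {t | ∀ h, 0 < h → h < 1 / ((n : ℝ) + 1) →
    ∀ k, 0 < k → k < 1 / ((n : ℝ) + 1) → dist (R t h) (R t k) ≤ 1 / ((m : ℝ) + 1)}
  have hAclosed : ∀ m n, IsClosed (A m n) := by
    intro m n
    simp only [A, ofPred_forall]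
    refine isClosed_iInter fun h => isClosed_iInter fun h0 => isClosed_iInter fun _ =>
      isClosed_iInter fun k => isClosed_iInter fun k0 => isClosed_iInter fun _ => ?_
    exact isClosed_le ((hR h h0).dist (hR k k0)) continuous_const
  have hmono : ∀ m, Antitone fun n => S \ A m n := by
    intro m i j hij t ht
    refine ⟨ht.1, fun hti => ht.2 ?_⟩
    have : 1 / ((j : ℝ) + 1) ≤ 1 / ((i : ℝ) + 1) := by gcongr
    intro h h0 h1 k k0 k1
    exact hti h h0 (h1.trans_le this) k k0 (k1.trans_le this)
  have hinter : ∀ m, ⋂ n, S \ A m n = ∅ := by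
    intro m
    refine eq_empty_iff_forall_notMem.2 fun t ht => ?_
    have htS : t ∈ S := (mem_iInter.1 ht 0).1
    have hm : (0 : ℝ) < 1 / ((m : ℝ) + 1) / 2 := by positivity
    obtain ⟨δ, hδ, hb⟩ := Metric.mem_nhdsWithin_iff.1
      ((hlim t htS) (Metric.ball_mem_nhds _ hm))
    obtain ⟨n, hn⟩ := exists_nat_one_div_lt hδ
    refine (mem_iInter.1 ht n).2 fun h h0 h1 k k0 k1 => ?_
    have key : ∀ h, 0 < h → h < 1 / ((n : ℝ) + 1) → dist (R t h) (l t) < 1 / ((m : ℝ) + 1) / 2 := by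
      intro h h0 h1
      refine hb ⟨?_, h0⟩
      rw [Metric.mem_ball, Real.dist_eq, sub_zero, abs_of_pos h0]
      exact h1.trans hn
    have := dist_triangle_right (R t h) (R t k) (l t)
    linarith [key h h0 h1, key k k0 k1]
  obtain ⟨ε, hε, hεsum⟩ := ENNReal.exists_pos_sum_of_countable' hpos.ne' ℕ
  have hex : ∀ m, ∃ n, volume (S \ A m n) < ε m := by
    intro m
    have ht : Tendsto (fun n => volume (S \ A m n)) atTop (𝓝 0) := by
      have := tendsto_measure_iInter_atTop (μ := volume) (s := fun n => S \ A m n)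
        (fun n => (hS.diff (hAclosed m n).measurableSet).nullMeasurableSet) (hmono m)
        ⟨0, measure_ne_top_of_subset sdiff_subset hfin⟩
      simpa [hinter m, Function.comp_def] using this
    exact (ht.eventually (gt_mem_nhds (hε m))).exists
  choose N hN using hex
  have hTmeas : MeasurableSet (S ∩ ⋂ m, A m (N m)) :=
    hS.inter (MeasurableSet.iInter fun m => (hAclosed m (N m)).measurableSet)
  have hTpos : 0 < volume (S ∩ ⋂ m, A m (N m)) := by
    rw [pos_iff_ne_zero]
    intro h0
    have hsub : S ⊆ (S ∩ ⋂ m, A m (N m)) ∪ ⋃ m, S \ A m (N m) := by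
      intro t ht
      by_cases h : ∀ m, t ∈ A m (N m)
      · exact Or.inl ⟨ht, mem_iInter.2 h⟩
      · push Not at h
        obtain ⟨m, hm⟩ := h
        exact Or.inr (mem_iUnion.2 ⟨m, ht, hm⟩)
    have : volume S < volume S := calc
      volume S ≤ volume (S ∩ ⋂ m, A m (N m)) + volume (⋃ m, S \ A m (N m)) :=
        (measure_mono hsub).trans (measure_union_le _ _)
      _ ≤ 0 + ∑' m, volume (S \ A m (N m)) := by
        rw [h0]; gcongr; exact measure_iUnion_le _
      _ ≤ ∑' m, ε m := by
        rw [zero_add]; exact ENNReal.tsum_le_tsum fun m => (hN m).le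
      _ < volume S := hεsum
    exact lt_irrefl _ this
  obtain ⟨K, hKT, hK, hKpos⟩ := hTmeas.exists_lt_isCompact hTpos
  have hunif : TendstoUniformlyOn (fun h t => R t h) l (𝓝[>] 0) K := by
    rw [Metric.tendstoUniformlyOn_iff]
    intro η hη
    obtain ⟨m, hm⟩ := exists_nat_one_div_lt hη
    have hNpos : (0 : ℝ) < 1 / ((N m : ℝ) + 1) := by positivity
    filter_upwards [Ioo_mem_nhdsGT hNpos] with h hh t ht
    refine lt_of_le_of_lt ?_ hm
    have htA : t ∈ A m (N m) := mem_iInter.1 (hKT ht).2 m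
    have hl := ((hlim t (hKT ht).1).dist (tendsto_const_nhds (x := R t h)))
    refine le_of_tendsto hl ?_
    filter_upwards [Ioo_mem_nhdsGT hNpos] with k hk
    exact htA k hk.1 hk.2 h hh.1 hh.2
  refine ⟨K, fun t ht => (hKT ht).1, hK, hKpos, ?_, hunif⟩
  refine hunif.continuousOn (Eventually.frequently ?_)
  filter_upwards [self_mem_nhdsWithin] with h hh using (hR h hh).continuousOn

theorem IsCompact.isGap_or_accumulates {K : Set ℝ} (hK : IsCompact K) {r t : ℝ} (hr : r ∈ K)
    (ht : t ∈ K) (hrt : r < t) :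
    (∃ d ≤ t, IsGap K r d) ∨ ∀ δ > 0, ∃ k ∈ K, r < k ∧ k < r + δ := by
  by_contra! ⟨h1, δ, hδ, h2⟩
  have hne : (K ∩ Ici (r + δ)).Nonempty := ⟨t, ht, h2 t ht hrt⟩
  obtain ⟨d, hd, hmin⟩ := (hK.inter_right isClosed_Ici).exists_isLeast hne
  have hd2 : r + δ ≤ d := hd.2
  refine h1 d (hmin ⟨ht, h2 t ht hrt⟩) ⟨hr, hd.1, by linarith, ?_⟩
  rintro x hx ⟨hx1, hx2⟩
  exact absurd (hmin ⟨hx, h2 x hx hx1⟩) (not_le.2 hx2)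

theorem IsCompact.exists_isGap {K : Set ℝ} (hK : IsCompact K) {a b s : ℝ} (ha : a ∈ K)
    (hb : b ∈ K) (hs : s ∈ Icc a b) (hsK : s ∉ K) :
    ∃ c d, IsGap K c d ∧ a ≤ c ∧ d ≤ b ∧ s ∈ Ioo c d := by
  obtain ⟨c, hc, hcmax⟩ := (hK.inter_right isClosed_Iic).exists_isGreatest ⟨a, ha, hs.1⟩
  obtain ⟨d, hd, hdmin⟩ := (hK.inter_right isClosed_Ici).exists_isLeast ⟨b, hb, hs.2⟩
  have hcs : c < s := lt_of_le_of_ne hc.2 fun h => hsK (h ▸ hc.1)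
  have hsd : s < d := lt_of_le_of_ne hd.2 fun h => hsK (h ▸ hd.1)
  refine ⟨c, d, ⟨hc.1, hd.1, hcs.trans hsd, ?_⟩, hcmax ⟨ha, hs.1⟩, hdmin ⟨hb, hs.2⟩, hcs, hsd⟩
  rintro x hx ⟨hx1, hx2⟩
  rcases le_total x s with h | h
  · exact absurd (hcmax ⟨hx, h⟩) (not_le.2 hx1)
  · exact absurd (hdmin ⟨hx, h⟩) (not_le.2 hx2)

theorem IsGap.eq_of_mem {K : Set ℝ} {c d c' d' s : ℝ} (h : IsGap K c d) (h' : IsGap K c' d')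
    (hs : s ∈ Ioo c d) (hs' : s ∈ Ioo c' d') : c = c' ∧ d = d' := by
  obtain ⟨hc, hd, -, hg⟩ := h
  obtain ⟨hc', hd', -, hg'⟩ := h'
  have h1 := hg c' hc'
  have h2 := hg d' hd'
  have h3 := hg' c hc
  have h4 := hg' d hd
  have := hs.1; have := hs.2; have := hs'.1; have := hs'.2
  constructor <;> grind

theorem continuousWithinAt_right_of_isGap {K : Set ℝ} (hK : IsCompact K) {u : ℝ → ℝ} {s b : ℝ}
    (hs : s ∈ K) (hb : b ∈ K) (hu : ContinuousWithinAt u K s)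
    (hgap : ∀ c d, IsGap K c d → ContinuousOn u (Icc c d))
    (hsmall : ∀ ε > 0, ∃ δ > 0, ∀ c d, IsGap K c d → |c - s| < δ → |d - s| < δ →
      ∀ t ∈ Icc c d, |u t - u s| ≤ ε) :
    ContinuousWithinAt u (Icc s b) s := by
  rcases lt_or_ge s b with hsb | hsb
  · rcases hK.isGap_or_accumulates hs hb hsb with ⟨d, -, hd⟩ | hacc
    · exact ((hgap s d hd) s (left_mem_Icc.2 hd.2.2.1.le)).mono_of_mem_nhdsWithin
        (nhdsWithin_mono _ Icc_subset_Ici_self (Icc_mem_nhdsGE hd.2.2.1))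
    · rw [Metric.continuousWithinAt_iff] at hu ⊢
      intro ε hε
      obtain ⟨δ, hδ, h1⟩ := hsmall (ε / 2) (half_pos hε)
      obtain ⟨η, hη, h2⟩ := hu ε hε
      obtain ⟨k, hk, hsk, hkδ⟩ := hacc δ hδ
      refine ⟨min η (k - s), lt_min hη (sub_pos.2 hsk), fun {x} hx hxs => ?_⟩
      obtain ⟨hx1, hx2⟩ := lt_min_iff.1 hxs
      by_cases hxK : x ∈ K
      · exact h2 hxK hx1
      · rw [Real.dist_eq, abs_of_nonneg (sub_nonneg.2 hx.1)] at hx2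
        obtain ⟨c, d, hcd, hsc, hdk, hxcd⟩ := hK.exists_isGap hs hk ⟨hx.1, by linarith⟩ hxK
        have := hcd.2.2.1
        have h3 := h1 c d hcd (abs_lt.2 ⟨by linarith, by linarith⟩)
          (abs_lt.2 ⟨by linarith, by linarith⟩) x (Ioo_subset_Icc_self hxcd)
        rw [Real.dist_eq]
        linarith
  · refine continuousWithinAt_singleton.mono fun x hx => ?_
    exact le_antisymm (hx.2.trans hsb) hx.1

theorem IsGap.neg {K : Set ℝ} {c d : ℝ} (h : IsGap (-K) c d) : IsGap K (-d) (-c) := by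
  obtain ⟨hc, hd, hcd, hg⟩ := h
  refine ⟨hd, hc, neg_lt_neg hcd, fun x hx hx' => hg (-x) (by simpa using hx) ⟨?_, ?_⟩⟩
  · linarith [hx'.2]
  · linarith [hx'.1]

theorem continuousWithinAt_left_of_isGap {K : Set ℝ} (hK : IsCompact K) {u : ℝ → ℝ} {s a : ℝ}
    (hs : s ∈ K) (ha : a ∈ K) (hu : ContinuousWithinAt u K s)
    (hgap : ∀ c d, IsGap K c d → ContinuousOn u (Icc c d))
    (hsmall : ∀ ε > 0, ∃ δ > 0, ∀ c d, IsGap K c d → |c - s| < δ → |d - s| < δ →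
      ∀ t ∈ Icc c d, |u t - u s| ≤ ε) :
    ContinuousWithinAt u (Icc a s) s := by
  have key : ContinuousWithinAt (fun t => u (-t)) (Icc (-s) (-a)) (-s) := by
    refine continuousWithinAt_right_of_isGap hK.neg (by simpa using hs) (by simpa using ha) ?_ ?_ ?_
    · refine ContinuousWithinAt.comp (t := K) (by simpa using hu) continuousWithinAt_neg ?_
      exact fun x hx => hx
    · intro c d hcd
      refine (hgap _ _ hcd.neg).comp continuousOn_neg ?_
      exact fun x hx => ⟨neg_le_neg hx.2, neg_le_neg hx.1⟩
    · intro ε hε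
      obtain ⟨δ, hδ, h⟩ := hsmall ε hε
      refine ⟨δ, hδ, fun c d hcd h1 h2 t ht => ?_⟩
      have e1 : |-d - s| = |d - -s| := by rw [← abs_neg]; congr 1; ring
      have e2 : |-c - s| = |c - -s| := by rw [← abs_neg]; congr 1; ring
      simpa using h _ _ hcd.neg (e1 ▸ h2) (e2 ▸ h1) (-t) ⟨neg_le_neg ht.2, neg_le_neg ht.1⟩
  have := ContinuousWithinAt.comp (f := fun t : ℝ => -t) (s := Icc a s) (x := s) key
    continuousWithinAt_neg (fun x hx => ⟨neg_le_neg hx.2, neg_le_neg hx.1⟩)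
  simpa [Function.comp_def] using this

/-- Gluing: a continuous function on a compact set `K` and continuous functions on its gaps, with
matching end values and small oscillation on small gaps, define a continuous function. -/
theorem exists_continuous_eqOn_isGap {K : Set ℝ} (hK : IsCompact K) (hne : K.Nonempty)
    {f : ℝ → ℝ} (hf : ContinuousOn f K) {φ : ℝ → ℝ → ℝ → ℝ}
    (hφ : ∀ c ∈ K, ∀ d ∈ K, c < d → ContinuousOn (φ c d) (Icc c d))
    (hφc : ∀ c ∈ K, ∀ d ∈ K, c < d → φ c d c = f c)
    (hφd : ∀ c ∈ K, ∀ d ∈ K, c < d → φ c d d = f d)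
    (hsmall : ∀ s ∈ K, ∀ ε > 0, ∀ᶠ p in pairFilter K s, ∀ t ∈ Icc p.1 p.2,
      |φ p.1 p.2 t - f s| ≤ ε) :
    ∃ u : ℝ → ℝ, Continuous u ∧ EqOn u f K ∧ ∀ c d, IsGap K c d → EqOn u (φ c d) (Icc c d) := by
  classical
  obtain ⟨a, ha, hamin⟩ := hK.exists_isLeast hne
  obtain ⟨b, hb, hbmax⟩ := hK.exists_isGreatest hne
  have hab : a ≤ b := hamin hb
  let v : ℝ → ℝ := fun s =>
    if h : ∃ p : ℝ × ℝ, IsGap K p.1 p.2 ∧ s ∈ Ioo p.1 p.2 then φ h.choose.1 h.choose.2 s else f s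
  have hvK : ∀ s ∈ K, v s = f s := by
    intro s hs
    have : ¬∃ p : ℝ × ℝ, IsGap K p.1 p.2 ∧ s ∈ Ioo p.1 p.2 :=
      fun ⟨p, hp, hsp⟩ => hp.2.2.2 s hs hsp
    simp only [v, dif_neg this]
  have hvgap : ∀ c d, IsGap K c d → EqOn v (φ c d) (Icc c d) := by
    intro c d hcd s hs
    rcases eq_or_lt_of_le hs.1 with rfl | hcs
    · rw [hvK _ hcd.1, hφc _ hcd.1 _ hcd.2.1 hcd.2.2.1]
    rcases eq_or_lt_of_le hs.2 with rfl | hsd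
    · rw [hvK _ hcd.2.1, hφd _ hcd.1 _ hcd.2.1 hcd.2.2.1]
    have h : ∃ p : ℝ × ℝ, IsGap K p.1 p.2 ∧ s ∈ Ioo p.1 p.2 := ⟨(c, d), hcd, hcs, hsd⟩
    obtain ⟨e1, e2⟩ := h.choose_spec.1.eq_of_mem hcd h.choose_spec.2 ⟨hcs, hsd⟩
    simp only [v, dif_pos h]
    rw [e1, e2]
  have hvcont : ContinuousOn v (Icc a b) := by
    intro s hs
    have hgapc : ∀ c d, IsGap K c d → ContinuousOn v (Icc c d) := fun c d hcd =>
      (hφ c hcd.1 d hcd.2.1 hcd.2.2.1).congr (hvgap c d hcd)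
    by_cases hsK : s ∈ K
    · have hvs : ContinuousWithinAt v K s := (hf s hsK).congr hvK (hvK s hsK)
      have hsm : ∀ ε > 0, ∃ δ > 0, ∀ c d, IsGap K c d → |c - s| < δ → |d - s| < δ →
          ∀ t ∈ Icc c d, |v t - v s| ≤ ε := by
        intro ε hε
        obtain ⟨δ, hδ, h⟩ := eventually_pairFilter_iff.1 (hsmall s hsK ε hε)
        refine ⟨δ, hδ, fun c d hcd h1 h2 t ht => ?_⟩
        rw [hvgap c d hcd ht, hvK s hsK]
        exact h c hcd.1 d hcd.2.1 hcd.2.2.1 h1 h2 t ht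
      rw [← Icc_union_Icc_eq_Icc hs.1 hs.2]
      exact (continuousWithinAt_left_of_isGap hK hsK ha hvs hgapc hsm).union
        (continuousWithinAt_right_of_isGap hK hsK hb hvs hgapc hsm)
    · obtain ⟨c, d, hcd, -, -, hscd⟩ := hK.exists_isGap ha hb hs hsK
      exact ((hgapc c d hcd).continuousAt (Icc_mem_nhds hscd.1 hscd.2)).continuousWithinAt
  have hsub : ∀ c ∈ K, ∀ d ∈ K, Icc c d ⊆ Icc a b := fun c hc d hd =>
    Icc_subset_Icc (hamin hc) (hbmax hd)
  have heq : EqOn (IccExtend hab ((Icc a b).domRestrict v)) v (Icc a b) := fun s hs => by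
    rw [IccExtend_of_mem hab _ hs]; rfl
  refine ⟨IccExtend hab ((Icc a b).domRestrict v), hvcont.domRestrict.Icc_extend', ?_, ?_⟩
  · exact fun s hs => (heq ⟨hamin hs, hbmax hs⟩).trans (hvK s hs)
  · exact fun c d hcd s hs => (heq (hsub c hcd.1 d hcd.2.1 hs)).trans (hvgap c d hcd hs)

/-- A fundamental theorem of calculus relative to a compact set: the derivative along `K` is only
needed at points of `K`, and the increments across gaps are prescribed. -/
theorem sub_eq_integral_of_isGap {K : Set ℝ} (hK : IsCompact K) {f u : ℝ → ℝ} (hu : Continuous u)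
    (hf : ∀ s ∈ K, HasDerivWithinAt f (u s) K s)
    (hgap : ∀ c d, IsGap K c d → ∫ t in c..d, u t = f d - f c) {s t : ℝ} (hs : s ∈ K)
    (ht : t ∈ K) : f t - f s = ∫ r in s..t, u r := by
  wlog hst : s ≤ t generalizing s t
  · rw [intervalIntegral.integral_symm, ← this ht hs (not_le.1 hst).le]
    ring
  have hintegral : ∀ c d, IntervalIntegrable u volume c d := fun c d => hu.intervalIntegrable c d
  set D : ℝ → ℝ := fun r => f r - ∫ q in s..r, u q with hD
  have hDder : ∀ r ∈ K, HasDerivWithinAt D 0 K r := by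
    intro r hr
    have h := (hf r hr).sub
      (intervalIntegral.integral_hasDerivAt_right (hintegral s r) (hu.stronglyMeasurableAtFilter _ _)
        hu.continuousAt).hasDerivWithinAt
    rwa [sub_self] at h
  have hDgap : ∀ c d, IsGap K c d → D d = D c := by
    intro c d hcd
    have h := hgap c d hcd
    have h2 := intervalIntegral.integral_add_adjacent_intervals (hintegral s c) (hintegral c d)
    simp only [hD]
    linarith
  have hDcont : ContinuousOn D K := fun r hr => (hDder r hr).continuousWithinAt
  have key : ∀ ε > 0, |D t - D s| ≤ ε * (t - s) := by
    intro ε hε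
    let M := {r ∈ K ∩ Icc s t | |D r - D s| ≤ ε * (r - s)}
    have hMcl : IsCompact M := by
      have hc : IsCompact (K ∩ Icc s t) := hK.inter_right isClosed_Icc
      refine hc.of_isClosed_subset ?_ (sep_subset _ _)
      exact hc.isClosed.isClosed_le (((hDcont.mono inter_subset_left).sub continuousOn_const).abs)
        (by fun_prop)
    obtain ⟨m, hm, hmax⟩ := hMcl.exists_isGreatest ⟨s, ⟨hs, left_mem_Icc.2 hst⟩, by simp⟩
    rcases eq_or_lt_of_le hm.1.2.2 with rfl | hmt
    · exact hm.2
    have step : ∃ k ∈ K, m < k ∧ k ≤ t ∧ |D k - D m| ≤ ε * (k - m) := by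
      rcases hK.isGap_or_accumulates hm.1.1 ht hmt with ⟨d, hdt, hd⟩ | hacc
      · refine ⟨d, hd.2.1, hd.2.2.1, hdt, ?_⟩
        rw [hDgap m d hd, sub_self, abs_zero]
        exact mul_nonneg hε.le (sub_nonneg.2 hd.2.2.1.le)
      · have h := (hasDerivWithinAt_iff_isLittleO.1 (hDder m hm.1.1)).def hε
        obtain ⟨δ, hδ, hb⟩ := Metric.mem_nhdsWithin_iff.1 h
        obtain ⟨k, hk, hmk, hkδ⟩ := hacc (min δ (t - m)) (lt_min hδ (sub_pos.2 hmt))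
        have h1 : k - m < δ := by linarith [min_le_left δ (t - m)]
        refine ⟨k, hk, hmk, by linarith [min_le_right δ (t - m)], ?_⟩
        have h2 := hb ⟨by rwa [Metric.mem_ball, Real.dist_eq, abs_of_pos (sub_pos.2 hmk)], hk⟩
        simpa [abs_of_pos (sub_pos.2 hmk)] using h2
    obtain ⟨k, hk, hmk, hkt, hDk⟩ := step
    have hkM : k ∈ M := by
      refine ⟨⟨hk, hm.1.2.1.trans hmk.le, hkt⟩, ?_⟩
      have h1 : |D m - D s| ≤ ε * (m - s) := hm.2
      have := abs_sub_le (D k) (D m) (D s)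
      linarith
    exact absurd (hmax hkM) (not_le.2 hmk)
  have h0 : D t = D s := by
    by_contra hne
    have hpos : 0 < |D t - D s| := abs_pos.2 (sub_ne_zero.2 hne)
    have h1 := key (|D t - D s| / (2 * (t - s + 1))) (by have := sub_nonneg.2 hst; positivity)
    have h2 : 0 ≤ t - s := sub_nonneg.2 hst
    rw [div_mul_eq_mul_div, le_div_iff₀ (by positivity)] at h1
    nlinarith
  simp only [hD, intervalIntegral.integral_same] at h0
  linarith

theorem exists_continuous_integral_eq_sub {K : Set ℝ} (hK : IsCompact K) (hne : K.Nonempty)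
    {f f' : ℝ → ℝ} (hf' : ContinuousOn f' K) (hf : ∀ s ∈ K, HasDerivWithinAt f (f' s) K s)
    (hlim : ∀ s ∈ K, Tendsto (fun p : ℝ × ℝ => (f p.2 - f p.1) / (p.2 - p.1)) (pairFilter K s)
      (𝓝 (f' s))) :
    ∃ v : ℝ → ℝ, Continuous v ∧ EqOn v f' K ∧ ∀ s ∈ K, ∀ t ∈ K, f t - f s = ∫ r in s..t, v r := by
  let m : ℝ × ℝ → ℝ := fun p => (f p.2 - f p.1) / (p.2 - p.1) - (f' p.1 + f' p.2) / 2
  let φ : ℝ → ℝ → ℝ → ℝ := fun c d t =>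
    f' c + (f' d - f' c) * ((t - c) / (d - c))
      + 6 * m (c, d) * (((t - c) / (d - c)) * (1 - (t - c) / (d - c)))
  have hintegral : ∀ c d, c < d → ∫ t in c..d, φ c d t = f d - f c := by
    intro c d hcd
    have hne : d - c ≠ 0 := (sub_pos.2 hcd).ne'
    let Φ : ℝ → ℝ := fun t => (d - c) * (f' c * ((t - c) / (d - c))
      + (f' d - f' c) * (((t - c) / (d - c)) ^ 2 / 2)
      + 6 * m (c, d) * (((t - c) / (d - c)) ^ 2 / 2 - ((t - c) / (d - c)) ^ 3 / 3))
    have hΦ : ∀ t, HasDerivAt Φ (φ c d t) t := by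
      intro t
      have h1 : HasDerivAt (fun t => (t - c) / (d - c)) (1 / (d - c)) t :=
        ((hasDerivAt_id t).sub_const c).div_const (d - c)
      have h2 := (h1.pow 2).div_const 2
      have h3 := (h1.pow 3).div_const 3
      refine ((((h1.const_mul (f' c)).add (h2.const_mul (f' d - f' c))).add
        ((h2.sub h3).const_mul (6 * m (c, d)))).const_mul (d - c)).congr_deriv ?_
      simp only [φ]
      generalize (t - c) / (d - c) = r
      generalize d - c = e at hne ⊢
      push_cast
      field_simp
    rw [intervalIntegral.integral_eq_sub_of_hasDerivAt (fun t _ => hΦ t)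
      (Continuous.intervalIntegrable (by fun_prop) _ _)]
    simp only [Φ, m, sub_self, zero_div, div_self hne]
    field_simp
    ring
  obtain ⟨v, hv, hvK, hvgap⟩ := exists_continuous_eqOn_isGap hK hne hf' (φ := φ)
    (fun c _ d _ _ => Continuous.continuousOn (by fun_prop))
    (fun c _ d _ _ => by simp [φ])
    (fun c _ d _ hcd => by simp [φ, div_self (sub_pos.2 hcd).ne'])
    (by
      intro s hs ε hε
      have hc := (hf' s hs).tendsto.comp (tendsto_fst_pairFilter K s)
      have hd := (hf' s hs).tendsto.comp (tendsto_snd_pairFilter K s)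
      have hB : Tendsto (fun p : ℝ × ℝ => |f' p.1 - f' s| + |f' p.2 - f' p.1| + 6 * |m p|)
          (pairFilter K s) (𝓝 0) := by
        have hm : Tendsto m (pairFilter K s) (𝓝 (f' s - (f' s + f' s) / 2)) :=
          (hlim s hs).sub ((hc.add hd).div_const 2)
        have := ((hc.sub_const (f' s)).abs.add (hd.sub hc).abs).add (hm.abs.const_mul 6)
        simpa using this
      filter_upwards [hB.eventually (gt_mem_nhds hε), (tendsto_nhdsWithin_iff.1
        (tendsto_sub_pairFilter K s)).2] with p hp hpos t ht
      have hpos : 0 < p.2 - p.1 := hpos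
      set r := (t - p.1) / (p.2 - p.1) with hr
      have hr0 : 0 ≤ r := div_nonneg (sub_nonneg.2 ht.1) hpos.le
      have hr1 : r ≤ 1 := (div_le_one hpos).2 (by linarith [ht.2])
      have hrr : |r * (1 - r)| ≤ 1 := by
        rw [abs_of_nonneg (mul_nonneg hr0 (by linarith))]; nlinarith
      have e : φ p.1 p.2 t - f' s = (f' p.1 - f' s) + (f' p.2 - f' p.1) * r
          + 6 * m p * (r * (1 - r)) := by simp only [φ, hr]; ring
      rw [e]
      have b1 : |(f' p.2 - f' p.1) * r| ≤ |f' p.2 - f' p.1| := by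
        rw [abs_mul, abs_of_nonneg hr0]
        exact mul_le_of_le_one_right (abs_nonneg _) hr1
      have b2 : |6 * m p * (r * (1 - r))| ≤ 6 * |m p| := by
        rw [abs_mul, abs_mul, abs_of_pos (by norm_num : (0:ℝ) < 6)]
        exact mul_le_of_le_one_right (by positivity) hrr
      have := abs_add_three (f' p.1 - f' s) ((f' p.2 - f' p.1) * r) (6 * m p * (r * (1 - r)))
      linarith)
  refine ⟨v, hv, hvK, fun s hs t ht => sub_eq_integral_of_isGap hK hv ?_ ?_ hs ht⟩
  · intro s hs
    rw [hvK hs]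
    exact hf s hs
  · intro c d hcd
    have hcd' := hcd.2.2.1
    rw [← hintegral c d hcd']
    refine intervalIntegral.integral_congr fun t ht => hvgap c d hcd ?_
    rwa [uIcc_of_le hcd'.le] at ht

theorem integral_normalized_poly_mul_deriv {X v : ℝ → ℝ} (hX : ∀ t, HasDerivAt X (v t) t)
    (hv : Continuous v) {c d : ℝ} (hL : X d - X c ≠ 0) (a : Fin 7 → ℝ) :
    ∫ t in c..d, (∑ i, a i * ((X t - X c) / (X d - X c)) ^ (i : ℕ)) * v t
      = (X d - X c) * ∑ i, a i / ((i : ℕ) + 1) := by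
  have hXc : Continuous X := continuous_iff_continuousAt.2 fun t => (hX t).continuousAt
  have hr : ∀ t, HasDerivAt (fun t => (X t - X c) / (X d - X c)) (v t / (X d - X c)) t :=
    fun t => ((hX t).sub_const _).div_const _
  have hF : ∀ t, HasDerivAt (fun t => (X d - X c) * ∑ i : Fin 7, a i *
      (((X t - X c) / (X d - X c)) ^ ((i : ℕ) + 1) / ((i : ℕ) + 1)))
      ((∑ i, a i * ((X t - X c) / (X d - X c)) ^ (i : ℕ)) * v t) t := by
    intro t
    have h := (HasDerivAt.fun_sum (u := Finset.univ) fun (i : Fin 7) _ =>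
      (((hr t).fun_pow ((i : ℕ) + 1)).div_const ((i : ℕ) + 1 : ℝ)).const_mul (a i)).const_mul
        (X d - X c)
    refine h.congr_deriv ?_
    rw [Finset.mul_sum, Finset.sum_mul]
    refine Finset.sum_congr rfl fun i _ => ?_
    have : ((i : ℕ) + 1 : ℝ) ≠ 0 := by positivity
    push_cast
    field_simp
  rw [intervalIntegral.integral_eq_sub_of_hasDerivAt (fun t _ => hF t)
    (Continuous.intervalIntegrable (by fun_prop) _ _)]
  simp [div_self hL, div_eq_mul_inv]

/-- The linear interpolation from `g₀` to `g₁` plus the bubble `r (1 - r) (α + β r + κ r²)`. -/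
noncomputable def bubblePoly (g₀ g₁ α β κ r : ℝ) : ℝ :=
  g₀ + (g₁ - g₀) * r + r * (1 - r) * (α + β * r + κ * r ^ 2)

theorem abs_bubblePoly_sub_le {g₀ g₁ α β κ r : ℝ} (hr : |r| ≤ 4) (g : ℝ) :
    |bubblePoly g₀ g₁ α β κ r - g| ≤
      |g₀ - g| + 4 * |g₁ - g₀| + 20 * |α| + 80 * |β| + 320 * |κ| := by
  have e : bubblePoly g₀ g₁ α β κ r - g = (g₀ - g) + (g₁ - g₀) * r + r * (1 - r) * α
      + r * (1 - r) * r * β + r * (1 - r) * r ^ 2 * κ := by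
    unfold bubblePoly; ring
  have h1 : |1 - r| ≤ 5 := by
    rw [abs_le] at hr ⊢; constructor <;> linarith [hr.1, hr.2]
  have h2 : |r| * |1 - r| ≤ 20 := by nlinarith [abs_nonneg r, abs_nonneg (1 - r)]
  have h3 : |r| * |1 - r| * |r| ≤ 80 := by nlinarith [abs_nonneg r, abs_nonneg (1 - r)]
  have h4 : |r| * |1 - r| * |r| ^ 2 ≤ 320 := by
    nlinarith [abs_nonneg r, mul_nonneg (mul_nonneg (abs_nonneg r) (abs_nonneg (1 - r)))
      (abs_nonneg r)]
  have b1 : |(g₁ - g₀) * r| ≤ 4 * |g₁ - g₀| := by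
    rw [abs_mul, mul_comm]; gcongr
  have b2 : |r * (1 - r) * α| ≤ 20 * |α| := by
    rw [abs_mul, abs_mul]; gcongr
  have b3 : |r * (1 - r) * r * β| ≤ 80 * |β| := by
    rw [abs_mul, abs_mul, abs_mul]; gcongr
  have b4 : |r * (1 - r) * r ^ 2 * κ| ≤ 320 * |κ| := by
    rw [abs_mul, abs_mul, abs_mul, abs_pow]; gcongr
  rw [e]
  have a1 := abs_add_three (g₀ - g) ((g₁ - g₀) * r) (r * (1 - r) * α)
  have a2 := abs_add_three (g₀ - g + (g₁ - g₀) * r + r * (1 - r) * α) (r * (1 - r) * r * β)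
    (r * (1 - r) * r ^ 2 * κ)
  linarith

theorem moments_bubblePoly {X v : ℝ → ℝ} (hX : ∀ t, HasDerivAt X (v t) t) (hv : Continuous v)
    {c d : ℝ} (hL : X d - X c ≠ 0) (g₀ g₁ α β κ : ℝ) {P r : ℝ → ℝ}
    (hr : ∀ t, r t = (X t - X c) / (X d - X c)) (hP : ∀ t, P t = bubblePoly g₀ g₁ α β κ (r t)) :
    (∫ t in c..d, P t * v t
      = (X d - X c) * (g₀ / 2 + g₁ / 2 + α / 6 + β / 12 + κ / 20)) ∧
    (∫ t in c..d, r t * (P t * v t)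
      = (X d - X c) * (g₀ / 6 + g₁ / 3 + α / 12 + β / 20 + κ / 30)) ∧
    (∫ t in c..d, r t ^ 2 * (P t * v t)
      = (X d - X c) * (g₀ / 12 + g₁ / 4 + α / 20 + β / 30 + κ / 42)) := by
  have h0 := integral_normalized_poly_mul_deriv hX hv hL
    ![g₀, g₁ - g₀ + α, β - α, κ - β, -κ, 0, 0]
  have h1 := integral_normalized_poly_mul_deriv hX hv hL
    ![0, g₀, g₁ - g₀ + α, β - α, κ - β, -κ, 0]
  have h2 := integral_normalized_poly_mul_deriv hX hv hL
    ![0, 0, g₀, g₁ - g₀ + α, β - α, κ - β, -κ]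
  simp only [← hr] at h0 h1 h2
  simp [Fin.sum_univ_seven] at h0 h1 h2
  refine ⟨?_, ?_, ?_⟩
  · convert h0 using 1
    · refine intervalIntegral.integral_congr fun t _ => ?_
      simp only [hP, bubblePoly]; ring
    · ring
  · convert h1 using 1
    · refine intervalIntegral.integral_congr fun t _ => ?_
      simp only [hP, bubblePoly]; ring
    · ring
  · convert h2 using 1
    · refine intervalIntegral.integral_congr fun t _ => ?_
      simp only [hP, bubblePoly]; ring
    · ring

theorem exists_engel_extension {K : Set ℝ} (hK : IsCompact K) (hne : K.Nonempty)
    {x y z w p q : ℝ → ℝ} (hp : ContinuousOn p K) (hq : ContinuousOn q K)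
    (hp0 : ∀ s ∈ K, p s ≠ 0) (hinj : ∀ c ∈ K, ∀ d ∈ K, c < d → x d - x c ≠ 0)
    (hx : ∀ s ∈ K, HasDerivWithinAt x (p s) K s) (hy : ∀ s ∈ K, HasDerivWithinAt y (q s) K s)
    (hz : ∀ s ∈ K, HasDerivWithinAt z (x s * q s) K s)
    (hw : ∀ s ∈ K, HasDerivWithinAt w (x s ^ 2 / 2 * q s) K s)
    (hlx : ∀ s ∈ K, Tendsto (fun a : ℝ × ℝ => (x a.2 - x a.1) / (a.2 - a.1)) (pairFilter K s)
      (𝓝 (p s)))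
    (hly : ∀ s ∈ K, Tendsto (fun a : ℝ × ℝ => (y a.2 - y a.1) / (a.2 - a.1)) (pairFilter K s)
      (𝓝 (q s)))
    (hlz : ∀ s ∈ K, Tendsto (fun a : ℝ × ℝ => (z a.2 - z a.1 - x a.1 * (y a.2 - y a.1))
      / (a.2 - a.1) ^ 2) (pairFilter K s) (𝓝 (p s * q s / 2)))
    (hlw : ∀ s ∈ K, Tendsto (fun a : ℝ × ℝ => (2 * (w a.2 - w a.1) - 2 * x a.1 * (z a.2 - z a.1)
      + x a.1 ^ 2 * (y a.2 - y a.1)) / (a.2 - a.1) ^ 3) (pairFilter K s)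
      (𝓝 (p s ^ 2 * q s / 3))) :
    ∃ X v u : ℝ → ℝ, Continuous v ∧ Continuous u ∧ (∀ t, HasDerivAt X (v t) t) ∧ EqOn X x K ∧
      ∀ s ∈ K, ∀ t ∈ K, y t - y s = ∫ r in s..t, u r ∧ z t - z s = ∫ r in s..t, X r * u r ∧
        w t - w s = ∫ r in s..t, X r ^ 2 / 2 * u r := by
  obtain ⟨v, hv, hvK, hvint⟩ := exists_continuous_integral_eq_sub hK hne hp hx hlx
  obtain ⟨k₀, hk₀⟩ := hne
  let X : ℝ → ℝ := fun t => x k₀ + ∫ r in k₀..t, v r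
  have hX : ∀ t, HasDerivAt X (v t) t := fun t =>
    (intervalIntegral.integral_hasDerivAt_right (hv.intervalIntegrable _ _)
      (hv.stronglyMeasurableAtFilter _ _) hv.continuousAt).const_add _
  have hXK : EqOn X x K := fun t ht => by
    have := hvint k₀ hk₀ t ht
    simp only [X]; linarith
  have hXc : Continuous X := continuous_iff_continuousAt.2 fun t => (hX t).continuousAt
  let g : ℝ → ℝ := fun s => q s / p s
  have hg : ContinuousOn g K := hq.div hp hp0
  let L : ℝ × ℝ → ℝ := fun a => x a.2 - x a.1
  let m₀ : ℝ × ℝ → ℝ := fun a => (y a.2 - y a.1) / L a - (g a.1 / 2 + g a.2 / 2)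
  let m₁ : ℝ × ℝ → ℝ := fun a => (z a.2 - z a.1 - x a.1 * (y a.2 - y a.1)) / L a ^ 2
    - (g a.1 / 6 + g a.2 / 3)
  let m₂ : ℝ × ℝ → ℝ := fun a => (2 * (w a.2 - w a.1) - 2 * x a.1 * (z a.2 - z a.1)
    + x a.1 ^ 2 * (y a.2 - y a.1)) / L a ^ 3 - (g a.1 / 12 + g a.2 / 4)
  let α : ℝ × ℝ → ℝ := fun a => 120 * m₀ a - 480 * m₁ a + 420 * m₂ a
  let β : ℝ × ℝ → ℝ := fun a => 2220 * m₁ a - 480 * m₀ a - 2100 * m₂ a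
  let κ : ℝ × ℝ → ℝ := fun a => 420 * m₀ a - 2100 * m₁ a + 2100 * m₂ a
  let φ : ℝ → ℝ → ℝ → ℝ := fun c d t =>
    bubblePoly (g c) (g d) (α (c, d)) (β (c, d)) (κ (c, d)) ((X t - X c) / (X d - X c))
  have hXne : ∀ c ∈ K, ∀ d ∈ K, c < d → X d - X c ≠ 0 := fun c hc d hd hcd => by
    rw [hXK hc, hXK hd]; exact hinj c hc d hd hcd
  have hlim : ∀ s ∈ K, Tendsto (fun a : ℝ × ℝ => |g a.1 - g s| + 4 * |g a.2 - g a.1|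
      + 20 * |α a| + 80 * |β a| + 320 * |κ a|) (pairFilter K s) (𝓝 0) := by
    intro s hs
    have hps := hp0 s hs
    have hc := (hg s hs).tendsto.comp (tendsto_fst_pairFilter K s)
    have hd := (hg s hs).tendsto.comp (tendsto_snd_pairFilter K s)
    have hpos := (tendsto_nhdsWithin_iff.1 (tendsto_sub_pairFilter K s)).2
    have t₀ : Tendsto m₀ (pairFilter K s) (𝓝 0) := by
      have h := ((hly s hs).div (hlx s hs) hps).sub ((hc.div_const 2).add (hd.div_const 2))
      have e : q s / p s - (g s / 2 + g s / 2) = 0 := by simp only [g]; ring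
      rw [e] at h
      refine h.congr' ?_
      filter_upwards [hpos] with a ha
      have ha' : a.2 - a.1 ≠ 0 := (show 0 < a.2 - a.1 from ha).ne'
      simp only [m₀, L, Function.comp_apply, Pi.div_apply]
      rw [div_div_div_cancel_right₀ ha']
    have t₁ : Tendsto m₁ (pairFilter K s) (𝓝 0) := by
      have h := ((hlz s hs).div ((hlx s hs).pow 2) (pow_ne_zero 2 hps)).sub
        ((hc.div_const 6).add (hd.div_const 3))
      have e : p s * q s / 2 / p s ^ 2 - (g s / 6 + g s / 3) = 0 := by
        simp only [g]; field_simp; ring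
      rw [e] at h
      refine h.congr' ?_
      filter_upwards [hpos] with a ha
      have ha' : a.2 - a.1 ≠ 0 := (show 0 < a.2 - a.1 from ha).ne'
      simp only [m₁, L, Function.comp_apply, Pi.div_apply]
      rw [div_pow, div_div_div_cancel_right₀ (pow_ne_zero 2 ha')]
    have t₂ : Tendsto m₂ (pairFilter K s) (𝓝 0) := by
      have h := ((hlw s hs).div ((hlx s hs).pow 3) (pow_ne_zero 3 hps)).sub
        ((hc.div_const 12).add (hd.div_const 4))
      have e : p s ^ 2 * q s / 3 / p s ^ 3 - (g s / 12 + g s / 4) = 0 := by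
        simp only [g]; field_simp; ring
      rw [e] at h
      refine h.congr' ?_
      filter_upwards [hpos] with a ha
      have ha' : a.2 - a.1 ≠ 0 := (show 0 < a.2 - a.1 from ha).ne'
      simp only [m₂, L, Function.comp_apply, Pi.div_apply]
      rw [div_pow, div_div_div_cancel_right₀ (pow_ne_zero 3 ha')]
    have tα : Tendsto α (pairFilter K s) (𝓝 0) := by
      simpa using ((t₀.const_mul 120).sub (t₁.const_mul 480)).add (t₂.const_mul 420)
    have tβ : Tendsto β (pairFilter K s) (𝓝 0) := by
      simpa using ((t₁.const_mul 2220).sub (t₀.const_mul 480)).sub (t₂.const_mul 2100)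
    have tκ : Tendsto κ (pairFilter K s) (𝓝 0) := by
      simpa using ((t₀.const_mul 420).sub (t₁.const_mul 2100)).add (t₂.const_mul 2100)
    simpa using (((((hc.sub_const (g s)).abs.add ((hd.sub hc).abs.const_mul 4)).add
      (tα.abs.const_mul 20)).add (tβ.abs.const_mul 80)).add (tκ.abs.const_mul 320))
  have hratio : ∀ s ∈ K, ∀ᶠ a in pairFilter K s, ∀ t ∈ Icc a.1 a.2,
      |(X t - X a.1) / (X a.2 - X a.1)| ≤ 4 := by
    intro s hs
    have hP : 0 < |p s| := abs_pos.2 (hp0 s hs)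
    have h1 : ∀ᶠ a in pairFilter K s, |p s| / 2 < |(x a.2 - x a.1) / (a.2 - a.1)| :=
      (hlx s hs).abs.eventually (lt_mem_nhds (half_lt_self hP))
    have h2 : ∀ᶠ a in pairFilter K s, ∀ t ∈ Icc a.1 a.2, |v t| ≤ 2 * |p s| := by
      have hvs : |v s| < 2 * |p s| := by rw [hvK hs]; linarith
      obtain ⟨δ, hδ, hb⟩ := Metric.mem_nhds_iff.1
        (hv.abs.continuousAt.eventually (gt_mem_nhds hvs))
      refine eventually_pairFilter_iff.2 ⟨δ, hδ, fun c _ d _ _ hc hd t ht => (hb ?_).le⟩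
      rw [Metric.mem_ball, Real.dist_eq, abs_lt]
      exact ⟨by linarith [(abs_lt.1 hc).1, ht.1], by linarith [(abs_lt.1 hd).2, ht.2]⟩
    have h3 : ∀ᶠ a in pairFilter K s, a.1 ∈ K ∧ a.2 ∈ K ∧ a.1 < a.2 :=
      eventually_inf_principal.2 (Eventually.of_forall fun _ h => h)
    filter_upwards [h1, h2, h3] with a h1 h2 h3 t ht
    have hpos : 0 < a.2 - a.1 := sub_pos.2 h3.2.2
    have h4 : |X t - X a.1| ≤ 2 * |p s| * (t - a.1) := by
      have := Convex.norm_image_sub_le_of_norm_hasDerivWithin_le (f := X) (f' := v)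
        (s := Icc a.1 a.2) (C := 2 * |p s|) (fun r _ => (hX r).hasDerivWithinAt) h2
        (convex_Icc _ _) (left_mem_Icc.2 h3.2.2.le) ht
      rwa [Real.norm_eq_abs, Real.norm_eq_abs, abs_of_nonneg (sub_nonneg.2 ht.1)] at this
    rw [← hXK h3.1, ← hXK h3.2.1, abs_div, abs_of_pos hpos, lt_div_iff₀ hpos] at h1
    rw [abs_div, div_le_iff₀ (lt_trans (by positivity) h1)]
    have h5 : 2 * |p s| * (t - a.1) ≤ 2 * |p s| * (a.2 - a.1) := by
      gcongr; exact ht.2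
    linarith
  obtain ⟨G, hG, hGK, hGgap⟩ := exists_continuous_eqOn_isGap hK ⟨k₀, hk₀⟩ hg (φ := φ)
    (fun c _ d _ _ => Continuous.continuousOn (by
      simp only [φ, bubblePoly]; fun_prop))
    (fun c _ d _ _ => by simp [φ, bubblePoly])
    (fun c hc d hd hcd => by simp [φ, bubblePoly, div_self (hXne c hc d hd hcd)])
    (by
      intro s hs ε hε
      filter_upwards [(hlim s hs).eventually (gt_mem_nhds hε), hratio s hs] with a h1 h2 t ht
      exact (abs_bubblePoly_sub_le (h2 t ht) (g s)).trans h1.le)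
  have huK : ∀ s ∈ K, G s * v s = q s := fun s hs => by
    rw [hGK hs, hvK hs]; exact div_mul_cancel₀ _ (hp0 s hs)
  have hgaps : ∀ c d, IsGap K c d →
      (∫ t in c..d, G t * v t = y d - y c) ∧ (∫ t in c..d, X t * (G t * v t) = z d - z c) ∧
      (∫ t in c..d, X t ^ 2 / 2 * (G t * v t) = w d - w c) := by
    intro c d hcd
    obtain ⟨hc, hd, hlt, hno⟩ := hcd
    have hL := hXne c hc d hd hlt
    have hLL : L (c, d) ≠ 0 := hinj c hc d hd hlt
    set r : ℝ → ℝ := fun t => (X t - X c) / (X d - X c) with hr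
    obtain ⟨M₀, M₁, M₂⟩ := moments_bubblePoly hX hv hL (g c) (g d) (α (c, d)) (β (c, d))
      (κ (c, d)) (P := φ c d) (r := r) (fun _ => rfl) (fun _ => rfl)
    have hrc : Continuous r := by fun_prop
    have hφc : Continuous (φ c d) := by simp only [φ, bubblePoly]; fun_prop
    have hXL : X d - X c = L (c, d) := by rw [hXK hc, hXK hd]
    have hXr : ∀ t, X t = x c + L (c, d) * r t := fun t => by
      simp only [hr]; rw [← hXL, mul_div_cancel₀ _ hL, hXK hc]; ring
    have hcongr : ∀ ψ : ℝ → ℝ,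
        ∫ t in c..d, ψ t * (G t * v t) = ∫ t in c..d, ψ t * (φ c d t * v t) := fun ψ =>
      intervalIntegral.integral_congr fun t ht => by
        rw [uIcc_of_le hlt.le] at ht
        rw [hGgap c d ⟨hc, hd, hlt, hno⟩ ht]
    have i₀ : IntervalIntegrable (fun t => φ c d t * v t) volume c d :=
      Continuous.intervalIntegrable (by fun_prop) _ _
    have i₁ : IntervalIntegrable (fun t => r t * (φ c d t * v t)) volume c d :=
      Continuous.intervalIntegrable (by fun_prop) _ _
    have i₂ : IntervalIntegrable (fun t => r t ^ 2 * (φ c d t * v t)) volume c d :=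
      Continuous.intervalIntegrable (by fun_prop) _ _
    rw [hXL] at M₀ M₁ M₂
    have E₀ : L (c, d) * (g c / 2 + g d / 2 + α (c, d) / 6 + β (c, d) / 12 + κ (c, d) / 20)
        = y d - y c := by
      have : g c / 2 + g d / 2 + α (c, d) / 6 + β (c, d) / 12 + κ (c, d) / 20
          = (y d - y c) / L (c, d) := by simp only [α, β, κ, m₀]; ring
      rw [this, mul_div_cancel₀ _ hLL]
    have E₁ : L (c, d) ^ 2 * (g c / 6 + g d / 3 + α (c, d) / 12 + β (c, d) / 20 + κ (c, d) / 30)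
        = z d - z c - x c * (y d - y c) := by
      have : g c / 6 + g d / 3 + α (c, d) / 12 + β (c, d) / 20 + κ (c, d) / 30
          = (z d - z c - x c * (y d - y c)) / L (c, d) ^ 2 := by simp only [α, β, κ, m₁]; ring
      rw [this, mul_div_cancel₀ _ (pow_ne_zero 2 hLL)]
    have E₂ : L (c, d) ^ 3 * (g c / 12 + g d / 4 + α (c, d) / 20 + β (c, d) / 30 + κ (c, d) / 42)
        = 2 * (w d - w c) - 2 * x c * (z d - z c) + x c ^ 2 * (y d - y c) := by
      have : g c / 12 + g d / 4 + α (c, d) / 20 + β (c, d) / 30 + κ (c, d) / 42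
          = (2 * (w d - w c) - 2 * x c * (z d - z c) + x c ^ 2 * (y d - y c)) / L (c, d) ^ 3 := by
        simp only [α, β, κ, m₂]; ring
      rw [this, mul_div_cancel₀ _ (pow_ne_zero 3 hLL)]
    refine ⟨?_, ?_, ?_⟩
    · have h := hcongr fun _ => 1
      simp only [one_mul] at h
      rw [h, M₀, E₀]
    · rw [hcongr X]
      have e : ∀ t, X t * (φ c d t * v t)
          = x c * (φ c d t * v t) + L (c, d) * (r t * (φ c d t * v t)) := fun t => by
        rw [hXr t]; ring
      simp only [e]
      rw [intervalIntegral.integral_add (i₀.const_mul _) (i₁.const_mul _),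
        intervalIntegral.integral_const_mul, intervalIntegral.integral_const_mul, M₀, M₁, E₀]
      linear_combination E₁
    · rw [hcongr fun t => X t ^ 2 / 2]
      have e : ∀ t, X t ^ 2 / 2 * (φ c d t * v t) = x c ^ 2 / 2 * (φ c d t * v t)
          + x c * L (c, d) * (r t * (φ c d t * v t))
          + L (c, d) ^ 2 / 2 * (r t ^ 2 * (φ c d t * v t)) := fun t => by
        rw [hXr t]; ring
      simp only [e]
      rw [intervalIntegral.integral_add ((i₀.const_mul _).add (i₁.const_mul _)) (i₂.const_mul _),
        intervalIntegral.integral_add (i₀.const_mul _) (i₁.const_mul _),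
        intervalIntegral.integral_const_mul, intervalIntegral.integral_const_mul,
        intervalIntegral.integral_const_mul, M₀, M₁, M₂, E₀]
      linear_combination x c * E₁ + E₂ / 2
  have huc : Continuous fun t => G t * v t := hG.mul hv
  have hXuc : Continuous fun t => X t * (G t * v t) := hXc.mul huc
  have hXXuc : Continuous fun t => X t ^ 2 / 2 * (G t * v t) := by fun_prop
  refine ⟨X, v, fun t => G t * v t, hv, huc, hX, hXK, fun s hs t ht => ⟨?_, ?_, ?_⟩⟩
  · refine sub_eq_integral_of_isGap hK huc (fun s hs => ?_) (fun c d h => (hgaps c d h).1) hs ht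
    simpa only [huK s hs] using hy s hs
  · refine sub_eq_integral_of_isGap hK hXuc (fun s hs => ?_) (fun c d h => (hgaps c d h).2.1) hs ht
    simpa only [huK s hs, hXK hs] using hz s hs
  · refine sub_eq_integral_of_isGap hK hXXuc (fun s hs => ?_) (fun c d h => (hgaps c d h).2.2) hs ht
    simpa only [huK s hs, hXK hs] using hw s hs

theorem eventually_forall_mem_Icc_add {P : ℝ → Prop} {t : ℝ} (h : ∀ᶠ s in 𝓝 t, P s) :
    ∀ᶠ h in 𝓝[>] (0 : ℝ), ∀ s ∈ Icc t (t + h), P s := by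
  obtain ⟨δ, hδ, hP⟩ := Metric.eventually_nhds_iff.1 h
  filter_upwards [Ioo_mem_nhdsGT hδ] with h hh s hs
  refine hP ?_
  rw [Real.dist_eq, abs_lt]
  constructor <;> linarith [hs.1, hs.2, hh.1, hh.2]

theorem tendsto_integral_div_pow {φ : ℝ → ℝ} {t κ : ℝ} {n : ℕ} (hφ : Continuous φ)
    (hκ : (fun s => φ s - κ * (s - t) ^ n) =o[𝓝 t] fun s => (s - t) ^ n) :
    Tendsto (fun h => (∫ s in t..t + h, φ s) / h ^ (n + 1)) (𝓝[>] 0) (𝓝 (κ / (n + 1))) := by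
  rw [Metric.tendsto_nhds]
  intro ε hε
  filter_upwards [eventually_forall_mem_Icc_add (hκ.def (half_pos hε)), self_mem_nhdsWithin]
    with h hs (h0 : 0 < h)
  have hpow : ∫ s in t..t + h, κ * (s - t) ^ n = κ / (n + 1) * h ^ (n + 1) := by
    rw [intervalIntegral.integral_const_mul,
      intervalIntegral.integral_comp_sub_right (fun s => s ^ n), integral_pow]
    simp
    ring
  have hsub : ∫ s in t..t + h, (φ s - κ * (s - t) ^ n) =
      (∫ s in t..t + h, φ s) - κ / (n + 1) * h ^ (n + 1) := by
    rw [intervalIntegral.integral_sub (hφ.intervalIntegrable _ _)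
      (Continuous.intervalIntegrable (by fun_prop) _ _), hpow]
  have hle : ‖∫ s in t..t + h, (φ s - κ * (s - t) ^ n)‖ ≤ ε / 2 * h ^ n * |t + h - t| := by
    refine intervalIntegral.norm_integral_le_of_norm_le_const fun s hst => ?_
    rw [uIoc_of_le (by linarith)] at hst
    refine (hs s ⟨hst.1.le, hst.2⟩).trans ?_
    rw [norm_pow, Real.norm_eq_abs, abs_of_pos (by linarith [hst.1])]
    have : s - t ≤ h := by linarith [hst.2]
    have : 0 ≤ s - t := by linarith [hst.1]
    gcongr
  rw [hsub, add_sub_cancel_left, abs_of_pos h0, Real.norm_eq_abs, mul_assoc, ← pow_succ] at hle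
  have hp : 0 < h ^ (n + 1) := by positivity
  rw [Real.dist_eq, div_sub' hp.ne', abs_div, abs_of_pos hp, div_lt_iff₀ hp, mul_comm (h ^ (n + 1))]
  nlinarith

/-- If `g` has a right Lebesgue point at `t` and `φ s ~ κ (s - t) ^ n`, then
`∫ φ g` over `[t, t + h]` is asymptotic to `κ g(t) h ^ (n + 1) / (n + 1)`. -/
theorem tendsto_integral_mul_div_pow {φ g : ℝ → ℝ} {t κ : ℝ} {n : ℕ} (hφ : Continuous φ)
    (hg : LocallyIntegrable g)
    (hL : Tendsto (fun h => (∫ s in t..t + h, |g s - g t|) / h) (𝓝[>] 0) (𝓝 0))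
    (hκ : (fun s => φ s - κ * (s - t) ^ n) =o[𝓝 t] fun s => (s - t) ^ n) :
    Tendsto (fun h => (∫ s in t..t + h, φ s * g s) / h ^ (n + 1)) (𝓝[>] 0)
      (𝓝 (κ * g t / (n + 1))) := by
  have hgi : ∀ c d, IntervalIntegrable (fun s => g s - g t) volume c d := fun c d =>
    (hg.integrableOn_isCompact isCompact_uIcc).intervalIntegrable.sub intervalIntegrable_const
  have hmain := (tendsto_integral_div_pow hφ hκ).mul_const (g t)
  have herr : Tendsto (fun h => (∫ s in t..t + h, φ s * (g s - g t)) / h ^ (n + 1)) (𝓝[>] 0)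
      (𝓝 0) := by
    have hC := hL.const_mul (|κ| + 1)
    rw [mul_zero] at hC
    refine squeeze_zero_norm' ?_ hC
    filter_upwards [eventually_forall_mem_Icc_add (hκ.def one_pos), self_mem_nhdsWithin]
      with h hs (h0 : 0 < h)
    have hle : ‖∫ s in t..t + h, φ s * (g s - g t)‖ ≤
        ∫ s in t..t + h, (|κ| + 1) * h ^ n * |g s - g t| := by
      refine intervalIntegral.norm_integral_le_of_norm_le (by linarith) (ae_of_all _ ?_)
        ((hgi _ _).abs.const_mul _)
      intro s hst
      rw [norm_mul]
      refine mul_le_mul_of_nonneg_right ?_ (abs_nonneg _)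
      have h1 := hs s ⟨hst.1.le, hst.2⟩
      rw [norm_pow, Real.norm_eq_abs, Real.norm_eq_abs, one_mul,
        abs_of_pos (show 0 < s - t by linarith [hst.1])] at h1
      have h2 : (s - t) ^ n ≤ h ^ n := by
        have : s - t ≤ h := by linarith [hst.2]
        have : 0 ≤ s - t := by linarith [hst.1]
        gcongr
      have h3 : |φ s| ≤ |φ s - κ * (s - t) ^ n| + |κ * (s - t) ^ n| := by
        simpa using abs_add_le (φ s - κ * (s - t) ^ n) (κ * (s - t) ^ n)
      have h4 : 0 ≤ (s - t) ^ n := pow_nonneg (by linarith [hst.1]) _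
      rw [abs_mul, abs_of_nonneg h4] at h3
      rw [Real.norm_eq_abs]
      nlinarith [abs_nonneg κ]
    rw [intervalIntegral.integral_const_mul] at hle
    rw [norm_div, norm_pow, Real.norm_of_nonneg h0.le, div_le_iff₀ (by positivity)]
    refine hle.trans_eq ?_
    field_simp
    ring
  have := hmain.add herr
  rw [add_zero, div_mul_eq_mul_div] at this
  refine this.congr fun h => ?_
  rw [div_mul_eq_mul_div, ← add_div, ← intervalIntegral.integral_mul_const,
    ← intervalIntegral.integral_add ((hφ.intervalIntegrable _ _).mul_const _)]
  · congr 1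
    exact intervalIntegral.integral_congr fun s _ => by ring
  · exact (hgi _ _).continuousOn_mul hφ.continuousOn

theorem ae_tendsto_integral_abs_sub_div {g : ℝ → ℝ} (hg : LocallyIntegrable g) :
    ∀ᵐ t, Tendsto (fun h => (∫ s in t..t + h, |g s - g t|) / h) (𝓝[>] 0) (𝓝 0) := by
  filter_upwards [(IsUnifLocDoublingMeasure.vitaliFamily (volume : Measure ℝ)
    1).ae_tendsto_average_norm_sub hg] with t ht
  have h1 : Tendsto (fun h : ℝ => t + h) (𝓝[>] 0) (𝓝[>] t) := by
    refine tendsto_nhdsWithin_iff.2 ⟨?_, ?_⟩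
    · have : Tendsto (fun h : ℝ => t + h) (𝓝 0) (𝓝 (t + 0)) := tendsto_const_nhds.add tendsto_id
      rw [add_zero] at this
      exact this.mono_left nhdsWithin_le_nhds
    · filter_upwards [self_mem_nhdsWithin] with h hh
      simpa using hh
  refine (ht.comp ((Real.tendsto_Icc_vitaliFamily_right t).comp h1)).congr' ?_
  filter_upwards [self_mem_nhdsWithin] with h (hh : 0 < h)
  simp only [Function.comp_apply, Real.norm_eq_abs]
  rw [setAverage_eq, intervalIntegral.integral_of_le (by linarith), integral_Icc_eq_integral_Ioc]
  simp [measureReal_def, hh.le, div_eq_inv_mul]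

theorem exists_measurableSet_subset_of_ae {T : Set ℝ} {P : ℝ → Prop} (hT : NullMeasurableSet T)
    (hpos : 0 < volume T) (hP : ∀ᵐ t, P t) :
    ∃ S ⊆ T, MeasurableSet S ∧ 0 < volume S ∧ ∀ t ∈ S, P t := by
  have hTP : (T ∩ {t | P t} : Set ℝ) =ᵐ[volume] T :=
    inter_ae_eq_left_of_ae_eq_univ (eventuallyEq_univ.2 hP)
  obtain ⟨S, hS, hSm, hSe⟩ := (hT.congr hTP.symm).exists_measurable_subset_ae_eq
  exact ⟨S, fun t ht => (hS ht).1, hSm, by rwa [measure_congr (hSe.trans hTP)],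
    fun t ht => (hS ht).2⟩

theorem HasDerivAt.tendsto_sub_div_right {x : ℝ → ℝ} {x' t : ℝ} (h : HasDerivAt x x' t) :
    Tendsto (fun h => (x (t + h) - x t) / h) (𝓝[>] 0) (𝓝 x') :=
  h.tendsto_slope_zero_right.congr fun h => by rw [smul_eq_mul, div_eq_inv_mul]

theorem HasDerivAt.isLittleO_sub_sub_mul_pow_one {x : ℝ → ℝ} {x' t : ℝ} (h : HasDerivAt x x' t) :
    (fun s => (x s - x t) - x' * (s - t) ^ 1) =o[𝓝 t] fun s => (s - t) ^ 1 := by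
  simpa [mul_comm] using hasDerivAt_iff_isLittleO.1 h

theorem HasDerivAt.isLittleO_sub_sq_sub {x : ℝ → ℝ} {x' t : ℝ} (h : HasDerivAt x x' t) :
    (fun s => (x s - x t) ^ 2 - x' ^ 2 * (s - t) ^ 2) =o[𝓝 t] fun s => (s - t) ^ 2 := by
  have h1 : (fun s => (x s - x t) - x' * (s - t)) =o[𝓝 t] fun s => s - t := by
    simpa using h.isLittleO_sub_sub_mul_pow_one
  have h2 : (fun s => (x s - x t) + x' * (s - t)) =O[𝓝 t] fun s => s - t :=
    h.isBigO_sub.add (Asymptotics.isBigO_const_mul_self x' _ _)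
  refine (h1.mul_isBigO h2).congr (fun s => by ring) fun s => by ring

section EngelLift

variable {f g x y z w : ℝ → ℝ}

theorem ae_engel_limits (hf : LocallyIntegrable f) (hg : LocallyIntegrable g)
    (hxc : Continuous x)
    (hx : ∀ s t, x t - x s = ∫ r in s..t, f r) (hy : ∀ s t, y t - y s = ∫ r in s..t, g r)
    (hz : ∀ s t, z t - z s = ∫ r in s..t, x r * g r)
    (hw : ∀ s t, w t - w s = ∫ r in s..t, x r ^ 2 / 2 * g r) :
    ∀ᵐ t, (HasDerivAt x (f t) t ∧ HasDerivAt y (g t) t ∧ HasDerivAt z (x t * g t) t ∧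
      HasDerivAt w (x t ^ 2 / 2 * g t) t) ∧
      Tendsto (fun h => (z (t + h) - z t - x t * (y (t + h) - y t)) / h ^ 2) (𝓝[>] 0)
        (𝓝 (f t * g t / 2)) ∧
      Tendsto (fun h => (2 * (w (t + h) - w t) - 2 * x t * (z (t + h) - z t)
        + x t ^ 2 * (y (t + h) - y t)) / h ^ 3) (𝓝[>] 0) (𝓝 (f t ^ 2 * g t / 3)) := by
  have hprim : ∀ {F ρ : ℝ → ℝ}, (∀ s t, F t - F s = ∫ r in s..t, ρ r) → LocallyIntegrable ρ →
      ∀ᵐ t, HasDerivAt F (ρ t) t := fun {F ρ} hF hρ => by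
    filter_upwards [LocallyIntegrable.ae_hasDerivAt_integral hρ] with t ht
    refine ((ht 0).const_add (F 0)).congr_of_eventuallyEq (Eventually.of_forall fun s => ?_)
    simp only [← hF, add_sub_cancel]
  have hxg : LocallyIntegrable fun r => x r * g r := hg.continuous_mul hxc
  have hxxg : LocallyIntegrable fun r => x r ^ 2 / 2 * g r := hg.continuous_mul (by fun_prop)
  have hI : ∀ c d, IntervalIntegrable g volume c d := fun c d =>
    (hg.integrableOn_isCompact isCompact_uIcc).intervalIntegrable
  have hI1 : ∀ c d, IntervalIntegrable (fun r => x r * g r) volume c d := fun c d =>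
    (hxg.integrableOn_isCompact isCompact_uIcc).intervalIntegrable
  have hI2 : ∀ c d, IntervalIntegrable (fun r => x r ^ 2 / 2 * g r) volume c d := fun c d =>
    (hxxg.integrableOn_isCompact isCompact_uIcc).intervalIntegrable
  filter_upwards [hprim hx hf, hprim hy hg, hprim hz hxg, hprim hw hxxg,
    ae_tendsto_integral_abs_sub_div hg] with t h1 h2 h3 h4 hL
  refine ⟨⟨h1, h2, h3, h4⟩, ?_, ?_⟩
  · have := tendsto_integral_mul_div_pow (n := 1) (by fun_prop) hg hL
      h1.isLittleO_sub_sub_mul_pow_one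
    convert this using 2
    · rename_i h
      rw [hz, hy, ← intervalIntegral.integral_const_mul,
        ← intervalIntegral.integral_sub (hI1 _ _) ((hI _ _).const_mul _)]
      congr 1
      exact intervalIntegral.integral_congr fun s _ => by ring
    · norm_num
  · have := tendsto_integral_mul_div_pow (n := 2) (by fun_prop) hg hL h1.isLittleO_sub_sq_sub
    convert this using 2
    · rename_i h
      rw [hz, hy, hw, ← intervalIntegral.integral_const_mul, ← intervalIntegral.integral_const_mul,
        ← intervalIntegral.integral_const_mul,
        ← intervalIntegral.integral_sub ((hI2 _ _).const_mul _) ((hI1 _ _).const_mul _),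
        ← intervalIntegral.integral_add (((hI2 _ _).const_mul _).sub ((hI1 _ _).const_mul _))
          ((hI _ _).const_mul _)]
      congr 1
      exact intervalIntegral.integral_congr fun s _ => by ring
    · norm_num

end EngelLift

section EngelCore

variable {f g x y z w : ℝ → ℝ} {a b : ℝ}

theorem exists_C1_engel_of_ne_zero (hf : LocallyIntegrable f) (hg : LocallyIntegrable g)
    (hxc : Continuous x) (hyc : Continuous y) (hzc : Continuous z) (hwc : Continuous w)
    (hx : ∀ s t, x t - x s = ∫ r in s..t, f r) (hy : ∀ s t, y t - y s = ∫ r in s..t, g r)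
    (hz : ∀ s t, z t - z s = ∫ r in s..t, x r * g r)
    (hw : ∀ s t, w t - w s = ∫ r in s..t, x r ^ 2 / 2 * g r)
    (hf0 : ¬∀ᵐ t ∂volume.restrict (Icc a b), f t = 0) :
    ∃ K ⊆ Icc a b, 0 < volume K ∧ ∃ X v u : ℝ → ℝ, Continuous v ∧ Continuous u ∧
      (∀ t, HasDerivAt X (v t) t) ∧ EqOn X x K ∧
      ∀ s ∈ K, ∀ t ∈ K, y t - y s = ∫ r in s..t, u r ∧ z t - z s = ∫ r in s..t, X r * u r ∧
        w t - w s = ∫ r in s..t, X r ^ 2 / 2 * u r := by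
  have hT : NullMeasurableSet {t ∈ Icc a b | f t ≠ 0} :=
    measurableSet_Icc.nullMeasurableSet.inter
      (hf.aestronglyMeasurable.aemeasurable.nullMeasurable (measurableSet_singleton 0).compl)
  have hTpos : 0 < volume {t ∈ Icc a b | f t ≠ 0} := by
    rw [pos_iff_ne_zero]
    contrapose! hf0
    rw [ae_restrict_iff' measurableSet_Icc, ae_iff]
    simpa [and_assoc] using hf0
  obtain ⟨S, hST, hSm, hSpos, hS⟩ := exists_measurableSet_subset_of_ae hT hTpos
    (ae_engel_limits hf hg hxc hx hy hz hw)
  let R : ℝ → ℝ → ℝ × ℝ × ℝ × ℝ := fun t h => ((x (t + h) - x t) / h, (y (t + h) - y t) / h,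
    (z (t + h) - z t - x t * (y (t + h) - y t)) / h ^ 2,
    (2 * (w (t + h) - w t) - 2 * x t * (z (t + h) - z t)
        + x t ^ 2 * (y (t + h) - y t)) / h ^ 3)
  let l : ℝ → ℝ × ℝ × ℝ × ℝ := fun t => (f t, g t, f t * g t / 2, f t ^ 2 * g t / 3)
  have hSfin : volume S ≠ ⊤ :=
    ((measure_mono (hST.trans inter_subset_left)).trans_lt measure_Icc_lt_top).ne
  obtain ⟨K₁, hK₁S, hK₁, hK₁pos, hlc, hunif⟩ := exists_isCompact_tendstoUniformlyOn (R := R) (l := l)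
    (fun h _ => by fun_prop) hSm hSpos hSfin fun t ht =>
      (hS t ht).1.1.tendsto_sub_div_right.prodMk_nhds
        ((hS t ht).1.2.1.tendsto_sub_div_right.prodMk_nhds
          ((hS t ht).2.1.prodMk_nhds (hS t ht).2.2))
  have hlim : ∀ s ∈ K₁, Tendsto (fun p : ℝ × ℝ => R p.1 (p.2 - p.1)) (pairFilter K₁ s) (𝓝 (l s)) :=
    fun s hs => hunif.tendsto_pairFilter hlc hs
  have hlx : ∀ s ∈ K₁, Tendsto (fun a : ℝ × ℝ => (x a.2 - x a.1) / (a.2 - a.1)) (pairFilter K₁ s)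
      (𝓝 (f s)) := fun s hs => (hlim s hs).fst_nhds.congr fun p => by simp [R]
  have hly : ∀ s ∈ K₁, Tendsto (fun a : ℝ × ℝ => (y a.2 - y a.1) / (a.2 - a.1)) (pairFilter K₁ s)
      (𝓝 (g s)) := fun s hs => (hlim s hs).snd_nhds.fst_nhds.congr fun p => by simp [R]
  have hlz : ∀ s ∈ K₁, Tendsto (fun a : ℝ × ℝ => (z a.2 - z a.1 - x a.1 * (y a.2 - y a.1))
      / (a.2 - a.1) ^ 2) (pairFilter K₁ s) (𝓝 (f s * g s / 2)) := fun s hs =>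
    (hlim s hs).snd_nhds.snd_nhds.fst_nhds.congr fun p => by simp [R]
  have hlw : ∀ s ∈ K₁, Tendsto (fun a : ℝ × ℝ => (2 * (w a.2 - w a.1)
      - 2 * x a.1 * (z a.2 - z a.1) + x a.1 ^ 2 * (y a.2 - y a.1)) / (a.2 - a.1) ^ 3)
      (pairFilter K₁ s) (𝓝 (f s ^ 2 * g s / 3)) := fun s hs =>
    (hlim s hs).snd_nhds.snd_nhds.snd_nhds.congr fun p => by simp [R]
  have hfc : ContinuousOn f K₁ := continuous_fst.comp_continuousOn hlc
  have hgc : ContinuousOn g K₁ := (continuous_fst.comp continuous_snd).comp_continuousOn hlc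
  have hf1 : ∀ s ∈ K₁, f s ≠ 0 := fun s hs => (hST (hK₁S hs)).2
  obtain ⟨s₁, hs₁, hloc⟩ := exists_mem_forall_mem_nhdsWithin_pos_measure hK₁pos.ne'
  obtain ⟨δ, hδ, hinj⟩ := eventually_pairFilter_iff.1 ((hlx s₁ hs₁).eventually_ne (hf1 s₁ hs₁))
  let K : Set ℝ := K₁ ∩ Metric.closedBall s₁ (δ / 2)
  have hKK : K ⊆ K₁ := inter_subset_left
  have hKpos : 0 < volume K := hloc _
    (inter_mem self_mem_nhdsWithin (mem_nhdsWithin_of_mem_nhds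
      (Metric.closedBall_mem_nhds _ (half_pos hδ))))
  have hKδ : ∀ c ∈ K, |c - s₁| < δ := fun c hc =>
    (Metric.mem_closedBall.1 hc.2).trans_lt (half_lt_self hδ)
  have hd : ∀ s ∈ K, _ := fun s hs => (hS s (hK₁S (hKK hs))).1
  refine ⟨K, fun t ht => (hST (hK₁S (hKK ht))).1, hKpos, ?_⟩
  exact exists_engel_extension (hK₁.inter_right Metric.isClosed_closedBall)
    (nonempty_of_measure_ne_zero hKpos.ne') (hfc.mono hKK) (hgc.mono hKK)
    (fun s hs => hf1 s (hKK hs))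
    (fun c hc d hd hcd h0 => hinj c (hKK hc) d (hKK hd) hcd (hKδ c hc) (hKδ d hd) (by simp [h0]))
    (fun s hs => (hd s hs).1.hasDerivWithinAt) (fun s hs => (hd s hs).2.1.hasDerivWithinAt)
    (fun s hs => (hd s hs).2.2.1.hasDerivWithinAt) (fun s hs => (hd s hs).2.2.2.hasDerivWithinAt)
    (fun s hs => (hlx s (hKK hs)).mono_left (pairFilter_mono hKK s))
    (fun s hs => (hly s (hKK hs)).mono_left (pairFilter_mono hKK s))
    (fun s hs => (hlz s (hKK hs)).mono_left (pairFilter_mono hKK s))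
    (fun s hs => (hlw s (hKK hs)).mono_left (pairFilter_mono hKK s))

theorem exists_C1_engel_of_eq_zero (hab : a < b) (hf : LocallyIntegrable f)
    (hg : LocallyIntegrable g)
    (hxc : Continuous x) (hyc : Continuous y)
    (hx : ∀ s t, x t - x s = ∫ r in s..t, f r) (hy : ∀ s t, y t - y s = ∫ r in s..t, g r)
    (hz : ∀ s t, z t - z s = ∫ r in s..t, x r * g r)
    (hw : ∀ s t, w t - w s = ∫ r in s..t, x r ^ 2 / 2 * g r)
    (hf0 : ∀ᵐ t ∂volume.restrict (Icc a b), f t = 0) :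
    ∃ K ⊆ Icc a b, 0 < volume K ∧ ∃ X v u : ℝ → ℝ, Continuous v ∧ Continuous u ∧
      (∀ t, HasDerivAt X (v t) t) ∧ EqOn X x K ∧
      ∀ s ∈ K, ∀ t ∈ K, y t - y s = ∫ r in s..t, u r ∧ z t - z s = ∫ r in s..t, X r * u r ∧
        w t - w s = ∫ r in s..t, X r ^ 2 / 2 * u r := by
  have hxa : ∀ t ∈ Icc a b, x t = x a := fun t ht => by
    rw [← sub_eq_zero, hx, intervalIntegral.integral_of_le ht.1]
    refine integral_eq_zero_of_ae (ae_restrict_of_ae_restrict_of_subset ?_ hf0)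
    exact Ioc_subset_Icc_self.trans (Icc_subset_Icc_right ht.2)
  obtain ⟨S, hST, hSm, hSpos, hS⟩ := exists_measurableSet_subset_of_ae
    (measurableSet_Icc (a := a) (b := b)).nullMeasurableSet (by simpa using hab)
    (ae_engel_limits hf hg hxc hx hy hz hw)
  obtain ⟨K, hKS, hK, hKpos, hlc, hunif⟩ := exists_isCompact_tendstoUniformlyOn
    (R := fun t h => (y (t + h) - y t) / h) (l := g) (fun h _ => by fun_prop) hSm hSpos
    ((measure_mono hST).trans_lt measure_Icc_lt_top).ne
    fun t ht => (hS t ht).1.2.1.tendsto_sub_div_right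
  obtain ⟨u, hu, -, hyu⟩ := exists_continuous_integral_eq_sub hK
    (nonempty_of_measure_ne_zero hKpos.ne') hlc
    (fun s hs => (hS s (hKS hs)).1.2.1.hasDerivWithinAt)
    fun s hs => (hunif.tendsto_pairFilter hlc hs).congr fun p => by simp
  have hKI : K ⊆ Icc a b := hKS.trans hST
  refine ⟨K, hKI, hKpos, fun _ => x a, 0, u, continuous_zero, hu, fun t => hasDerivAt_const t _,
    fun t ht => (hxa t (hKI ht)).symm, fun s hs t ht => ?_⟩
  have hsub : uIcc s t ⊆ Icc a b := uIcc_subset_Icc (hKI hs) (hKI ht)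
  refine ⟨hyu s hs t ht, ?_, ?_⟩
  · rw [hz, intervalIntegral.integral_const_mul, ← hyu s hs t ht, hy,
      ← intervalIntegral.integral_const_mul]
    exact intervalIntegral.integral_congr fun r hr => by simp only [hxa r (hsub hr)]
  · rw [hw, intervalIntegral.integral_const_mul, ← hyu s hs t ht, hy,
      ← intervalIntegral.integral_const_mul]
    exact intervalIntegral.integral_congr fun r hr => by simp only [hxa r (hsub hr)]

end EngelCore

theorem ae_deriv_eq_of_eq_add_integral {F ρ : ℝ → ℝ} {a b : ℝ} (hab : a < b)
    (hρ : IntervalIntegrable ρ volume a b)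
    (hF : ∀ t ∈ Icc a b, F t = F a + ∫ s in a..t, ρ s) :
    ∀ᵐ t ∂volume.restrict (Icc a b), deriv F t = ρ t := by
  rw [← Measure.restrict_congr_set (Ioo_ae_eq_Icc (μ := volume)),
    ae_restrict_iff' measurableSet_Ioo]
  filter_upwards [hρ.ae_hasDerivAt_integral] with t ht htab
  rw [uIcc_of_le hab.le] at ht
  refine (((ht (Ioo_subset_Icc_self htab) a (left_mem_Icc.2 hab.le)).const_add
    (F a)).congr_of_eventuallyEq ?_).deriv
  filter_upwards [Icc_mem_nhds htab.1 htab.2] with s hs using hF s hs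

theorem contDiff_one_of_hasDerivAt {F F' : ℝ → ℝ} (h : ∀ t, HasDerivAt F (F' t) t)
    (hc : Continuous F') : ContDiff ℝ 1 F :=
  contDiff_one_iff_deriv.2 ⟨fun t => (h t).differentiableAt, by
    rwa [show deriv F = F' from funext fun t => (h t).deriv]⟩

theorem hasDerivAt_const_add_integral {u : ℝ → ℝ} (hu : Continuous u) (c k t : ℝ) :
    HasDerivAt (fun t => c + ∫ r in k..t, u r) (u t) t :=
  (intervalIntegral.integral_hasDerivAt_right (hu.intervalIntegrable _ _)
    (hu.stronglyMeasurableAtFilter _ _) hu.continuousAt).const_add _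

/-- Every horizontal curve on `[a, b]` is the restriction of a globally defined one with
locally integrable controls. -/
theorem HorizontalEngel.exists_global {γ : ℝ → Fin 4 → ℝ} {a b : ℝ} (hab : a < b)
    (hγ : HorizontalEngel γ a b) :
    ∃ f g x y z w : ℝ → ℝ, LocallyIntegrable f ∧ LocallyIntegrable g ∧
      (Continuous x ∧ Continuous y ∧ Continuous z ∧ Continuous w) ∧
      (∀ s t, x t - x s = ∫ r in s..t, f r) ∧ (∀ s t, y t - y s = ∫ r in s..t, g r) ∧
      (∀ s t, z t - z s = ∫ r in s..t, x r * g r) ∧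
      (∀ s t, w t - w s = ∫ r in s..t, x r ^ 2 / 2 * g r) ∧
      ∀ t ∈ Icc a b, x t = γ t 0 ∧ y t = γ t 1 ∧ z t = γ t 2 ∧ w t = γ t 3 := by
  obtain ⟨hac, hae⟩ := hγ
  choose ρ hρ hγρ using hac
  have hext : ∀ i, Integrable ((Icc a b).indicator (ρ i)) := fun i =>
    ((intervalIntegrable_iff_integrableOn_Icc_of_le hab.le).1 (hρ i)).integrable_indicator
      measurableSet_Icc
  have hprim : ∀ {σ : ℝ → ℝ} (c : ℝ), LocallyIntegrable σ →
      Continuous (fun t => c + ∫ r in a..t, σ r) ∧ ∀ s t,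
        (c + ∫ r in a..t, σ r) - (c + ∫ r in a..s, σ r) = ∫ r in s..t, σ r := fun c hσ => by
    have hI := fun p q => (hσ.integrableOn_isCompact isCompact_uIcc).intervalIntegrable
      (a := p) (b := q)
    refine ⟨continuous_const.add (intervalIntegral.continuous_primitive hI a), fun s t => ?_⟩
    rw [add_sub_add_left_eq_sub, intervalIntegral.integral_interval_sub_left (hI _ _) (hI _ _)]
  have hagree : ∀ {σ : ℝ → ℝ} (i : Fin 4), (∀ᵐ t ∂volume.restrict (Icc a b), σ t = ρ i t) →
      ∀ t ∈ Icc a b, (γ a i + ∫ r in a..t, σ r) = γ t i := fun {σ} i hσ t ht => by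
    refine Eq.trans ?_ (hγρ i t ht).symm
    rw [intervalIntegral.integral_of_le ht.1, intervalIntegral.integral_of_le ht.1]
    congr 1
    exact integral_congr_ae (ae_restrict_of_ae_restrict_of_subset
      (Ioc_subset_Icc_self.trans (Icc_subset_Icc_right ht.2)) hσ)
  have hind : ∀ i, ∀ᵐ t ∂volume.restrict (Icc a b), (Icc a b).indicator (ρ i) t = ρ i t :=
    fun i => (ae_restrict_iff' measurableSet_Icc).2
      (Eventually.of_forall fun t ht => indicator_of_mem ht _)
  let f : ℝ → ℝ := (Icc a b).indicator (ρ 0)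
  let g : ℝ → ℝ := (Icc a b).indicator (ρ 1)
  have hf : LocallyIntegrable f := (hext 0).locallyIntegrable
  have hg : LocallyIntegrable g := (hext 1).locallyIntegrable
  let x : ℝ → ℝ := fun t => γ a 0 + ∫ r in a..t, f r
  have hxc : Continuous x := (hprim _ hf).1
  have hxγ : ∀ t ∈ Icc a b, x t = γ t 0 := hagree 0 (hind 0)
  have hxg : LocallyIntegrable fun r => x r * g r := hg.continuous_mul hxc
  have hxxg : LocallyIntegrable fun r => x r ^ 2 / 2 * g r := hg.continuous_mul (by fun_prop)
  have hderiv := fun i => ae_deriv_eq_of_eq_add_integral hab (hρ i) (hγρ i)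
  have h2 : ∀ᵐ t ∂volume.restrict (Icc a b), x t * g t = ρ 2 t := by
    filter_upwards [hae, hderiv 1, hderiv 2, hind 1, ae_restrict_mem measurableSet_Icc]
      with t ht h1 h2 hi hm
    rw [← h2, ht.2.1, h1, hxγ t hm, ← hi]
  have h3 : ∀ᵐ t ∂volume.restrict (Icc a b), x t ^ 2 / 2 * g t = ρ 3 t := by
    filter_upwards [hae, hderiv 1, hderiv 3, hind 1, ae_restrict_mem measurableSet_Icc]
      with t ht h1 h3 hi hm
    rw [← h3, ht.2.2, h1, hxγ t hm, ← hi]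
    ring
  exact ⟨f, g, x, fun t => γ a 1 + ∫ r in a..t, g r, fun t => γ a 2 + ∫ r in a..t, x r * g r,
    fun t => γ a 3 + ∫ r in a..t, x r ^ 2 / 2 * g r, hf, hg,
    ⟨hxc, (hprim _ hg).1, (hprim _ hxg).1, (hprim _ hxxg).1⟩, (hprim _ hf).2, (hprim _ hg).2,
    (hprim _ hxg).2, (hprim _ hxxg).2, fun t ht => ⟨hxγ t ht, hagree 1 (hind 1) t ht,
      hagree 2 h2 t ht, hagree 3 h3 t ht⟩⟩

/-- Every horizontal curve in the Engel group agrees with some `C¹` horizontal curve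
on a set of positive Lebesgue measure. -/
theorem engel_intersect_C1_positive_measure (a b : ℝ) (hab : a < b)
    (γ : ℝ → Fin 4 → ℝ) (hγ : HorizontalEngel γ a b) :
    ∃ Γ : ℝ → Fin 4 → ℝ, C1HorizontalEngel Γ a b ∧
      0 < volume {t ∈ Icc a b | Γ t = γ t} := by
  obtain ⟨f, g, x, y, z, w, hf, hg, ⟨hxc, hyc, hzc, hwc⟩, hx, hy, hz, hw, hγ'⟩ :=
    hγ.exists_global hab
  obtain ⟨K, hKI, hKpos, X, v, u, hv, hu, hX, hXK, hK⟩ :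
      ∃ K ⊆ Icc a b, 0 < volume K ∧ ∃ X v u : ℝ → ℝ, Continuous v ∧ Continuous u ∧
      (∀ t, HasDerivAt X (v t) t) ∧ EqOn X x K ∧
      ∀ s ∈ K, ∀ t ∈ K, y t - y s = ∫ r in s..t, u r ∧ z t - z s = ∫ r in s..t, X r * u r ∧
        w t - w s = ∫ r in s..t, X r ^ 2 / 2 * u r := by
    by_cases hf0 : ∀ᵐ t ∂volume.restrict (Icc a b), f t = 0
    · exact exists_C1_engel_of_eq_zero hab hf hg hxc hyc hx hy hz hw hf0
    · exact exists_C1_engel_of_ne_zero hf hg hxc hyc hzc hwc hx hy hz hw hf0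
  obtain ⟨k, hk⟩ := nonempty_of_measure_ne_zero hKpos.ne'
  have hXc : Continuous X := continuous_iff_continuousAt.2 fun t => (hX t).continuousAt
  have hXu : Continuous fun r => X r * u r := hXc.mul hu
  have hXXu : Continuous fun r => X r ^ 2 / 2 * u r := by fun_prop
  have h1 := hasDerivAt_const_add_integral hu (y k) k
  have h2 := hasDerivAt_const_add_integral hXu (z k) k
  have h3 := hasDerivAt_const_add_integral hXXu (w k) k
  refine ⟨fun t => ![X t, y k + ∫ r in k..t, u r, z k + ∫ r in k..t, X r * u r,
    w k + ∫ r in k..t, X r ^ 2 / 2 * u r], ⟨fun i => ?_, fun t ht => ?_⟩,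
    hKpos.trans_le (measure_mono fun t ht => ⟨hKI ht, ?_⟩)⟩
  · fin_cases i
    · exact (contDiff_one_of_hasDerivAt hX hv).contDiffOn
    · exact (contDiff_one_of_hasDerivAt h1 hu).contDiffOn
    · exact (contDiff_one_of_hasDerivAt h2 hXu).contDiffOn
    · exact (contDiff_one_of_hasDerivAt h3 hXXu).contDiffOn
  · have hU := uniqueDiffOn_Icc hab t ht
    have e1 := (h1 t).hasDerivWithinAt.derivWithin hU
    have e2 := (h2 t).hasDerivWithinAt.derivWithin hU
    have e3 := (h3 t).hasDerivWithinAt.derivWithin hU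
    refine ⟨e2.trans ?_, e3.trans ?_⟩
    · exact congrArg (X t * ·) e1.symm
    · refine Eq.trans ?_ (congrArg ((1 / 2) * X t ^ 2 * ·) e1.symm)
      ring
  · obtain ⟨g0, g1, g2, g3⟩ := hγ' t (hKI ht)
    obtain ⟨k1, k2, k3⟩ := hK k hk t ht
    funext i
    fin_cases i
    · exact (hXK ht).trans g0
    · exact (congrArg (y k + ·) k1.symm).trans ((add_sub_cancel _ _).trans g1)
    · exact (congrArg (z k + ·) k2.symm).trans ((add_sub_cancel _ _).trans g2)
    · exact (congrArg (w k + ·) k3.symm).trans ((add_sub_cancel _ _).trans g3)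
end

section
/- Let b ∈ ℝ with b ≠ 0, and let γ = (γ₁,γ₂,γ₃,γ₄) : [0,1] → ℝ⁴ be a C¹ horizontal curve in the Engel group with γ(0) = (0,0,0,0) such that √(γ₁'(t)² + (γ₂'(t) − b)²) < |b|/2 for every t ∈ [0,1]. Then b·γ₄(1) ≥ 0, and moreover b·γ₄(1) > 0 unless γ₁(t) = 0 for all t ∈ [0,1]. In particular, no point p = (p₁,p₂,p₃,p₄) ∈ ℝ⁴ with b·p₄ < 0 is the endpoint γ(1) of such a curve. -/
open MeasureTheory Set

/-- A real number at distance less than `|b| / 2` from `b` has the same sign as `b`. -/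
lemma mul_pos_of_sqrt_sq_add_sq_lt {b u v : ℝ} (h : √(v ^ 2 + (u - b) ^ 2) < |b| / 2) :
    0 < b * u := by
  have hlt : |u - b| < |b| / 2 :=
    (Real.abs_le_sqrt (le_add_of_nonneg_left (sq_nonneg v))).trans_lt h
  have hb : 0 < |b| := by linarith [abs_nonneg (u - b)]
  have habs : |b * (u - b)| = |b| * |u - b| := abs_mul _ _
  nlinarith [neg_abs_le (b * (u - b)), sq_abs b]

/-- A monotone function on `[x, y]` that does not increase from `x` to `y` has vanishing
derivative. -/
lemma derivWithin_eq_zero_of_monotoneOn_of_le {f : ℝ → ℝ} {x y : ℝ}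
    (hf : MonotoneOn f (Icc x y)) (hxy : f y ≤ f x) {t : ℝ} (ht : t ∈ Icc x y) :
    derivWithin f (Icc x y) t = 0 := by
  have hle : x ≤ y := ht.1.trans ht.2
  have hconst : ∀ s ∈ Icc x y, f s = f x := fun s hs =>
    le_antisymm ((hf hs (right_mem_Icc.2 hle) hs.2).trans hxy) (hf (left_mem_Icc.2 hle) hs hs.1)
  rw [derivWithin_congr (f := fun _ => f x) hconst (hconst t ht)]
  simp

/-- Key estimate showing `b X₂` (with `b ≠ 0`) is not pliable in the Engel group:
any `C¹` horizontal curve starting at the origin whose horizontal velocity stays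
within `|b|/2` of `(0,b)` has `b·γ₄(1) ≥ 0`, with strict inequality unless
`γ₁ ≡ 0`; in particular its endpoint cannot have fourth coordinate of sign
opposite to `b`. -/
theorem engel_X2_not_pliable_estimate (b : ℝ) (hb : b ≠ 0)
    (γ : ℝ → Fin 4 → ℝ) (hγ : C1HorizontalEngel γ 0 1)
    (h0 : γ 0 = fun _ => 0)
    (hclose : ∀ t ∈ Icc (0:ℝ) 1,
      Real.sqrt ((derivWithin (fun s => γ s 0) (Icc (0:ℝ) 1) t)^2 +
        (derivWithin (fun s => γ s 1) (Icc (0:ℝ) 1) t - b)^2) < |b| / 2) :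
    0 ≤ b * γ 1 3 ∧
    ((¬ ∀ t ∈ Icc (0:ℝ) 1, γ t 0 = 0) → 0 < b * γ 1 3) ∧
    ∀ p : Fin 4 → ℝ, b * p 3 < 0 → γ 1 ≠ p := by
  obtain ⟨hC, hH⟩ := hγ
  have hpos : ∀ t ∈ Icc (0:ℝ) 1, 0 < b * derivWithin (fun s => γ s 1) (Icc (0:ℝ) 1) t :=
    fun t ht => mul_pos_of_sqrt_sq_add_sq_lt (hclose t ht)
  have hdiff : DifferentiableOn ℝ (fun t => γ t 3) (Icc 0 1) := (hC 3).differentiableOn one_ne_zero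
  have hderiv : ∀ t ∈ Icc (0:ℝ) 1, derivWithin (fun s => b * γ s 3) (Icc (0:ℝ) 1) t
      = 1 / 2 * γ t 0 ^ 2 * (b * derivWithin (fun s => γ s 1) (Icc (0:ℝ) 1) t) := by
    intro t ht
    rw [derivWithin_const_mul b (hdiff t ht), (hH t ht).2]
    ring
  have hmono : MonotoneOn (fun t => b * γ t 3) (Icc (0:ℝ) 1) := by
    refine monotoneOn_of_deriv_nonneg (convex_Icc 0 1) (hdiff.const_mul b).continuousOn
      ((hdiff.const_mul b).mono interior_subset) fun t ht => ?_
    have htI := interior_subset ht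
    rw [← derivWithin_of_mem_nhds (mem_interior_iff_mem_nhds.1 ht), hderiv t htI]
    have := hpos t htI
    positivity
  have hzero : b * γ 0 3 = 0 := by simp [h0]
  have hnonneg : 0 ≤ b * γ 1 3 :=
    hzero.symm.le.trans
      (hmono (left_mem_Icc.2 zero_le_one) (right_mem_Icc.2 zero_le_one) zero_le_one)
  refine ⟨hnonneg, fun hne => ?_, fun p hp hγp => ?_⟩
  · by_contra! hle
    refine hne fun t ht => ?_
    have h := derivWithin_eq_zero_of_monotoneOn_of_le hmono (hle.trans hzero.symm.le) ht
    rw [hderiv t ht] at h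
    simpa [(hpos t ht).ne'] using h
  · rw [hγp] at hnonneg
    exact hnonneg.not_gt hp
end

section
/- Let a, b ∈ ℝ with a ≠ 0. Then for every r > 0 the set F(B(0,r)) = {γ_p(1) : p ∈ ℝ⁴, |p| < r} is a neighborhood of the point (a, b, ab/2, a²b/6) in ℝ⁴; in particular F(0,0,0,0) = (a, b, ab/2, a²b/6). -/
open MeasureTheory Set

/-- The curve `γ_p : [0,1] → ℝ⁴` with parameter `p = (c,d₁,d₂,d₃)` used in the
pliability argument in the Engel group: `γ_p(0) = 0`,
`γ_{p,1}' = a + ct`, `γ_{p,2}' = b + d₁t + d₂t² + d₃t³`,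
`γ_{p,3}' = γ_{p,2}'·γ_{p,1}` and `γ_{p,4}' = (1/2)·γ_{p,2}'·γ_{p,1}²`.
(These conditions determine the `C¹` curve uniquely.) -/
def IsEngelPolyCurve (a b : ℝ) (p : Fin 4 → ℝ) (γ : ℝ → Fin 4 → ℝ) : Prop :=
  (γ 0 = fun _ => 0) ∧
  ∀ t ∈ Icc (0:ℝ) 1,
    HasDerivWithinAt (fun s => γ s 0) (a + p 0 * t) (Icc (0:ℝ) 1) t ∧
    HasDerivWithinAt (fun s => γ s 1)
      (b + p 1 * t + p 2 * t^2 + p 3 * t^3) (Icc (0:ℝ) 1) t ∧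
    HasDerivWithinAt (fun s => γ s 2)
      ((b + p 1 * t + p 2 * t^2 + p 3 * t^3) * γ t 0) (Icc (0:ℝ) 1) t ∧
    HasDerivWithinAt (fun s => γ s 3)
      ((1/2) * (b + p 1 * t + p 2 * t^2 + p 3 * t^3) * (γ t 0)^2) (Icc (0:ℝ) 1) t

/-- Two functions on `[0,1]` with the same one-sided derivative and the same value at `0` agree. -/
lemma eqOn_Icc_of_hasDerivWithinAt_eq {f g f' : ℝ → ℝ}
    (hf : ∀ t ∈ Icc (0:ℝ) 1, HasDerivWithinAt f (f' t) (Icc 0 1) t)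
    (hg : ∀ t ∈ Icc (0:ℝ) 1, HasDerivWithinAt g (f' t) (Icc 0 1) t)
    (h0 : f 0 = g 0) : EqOn f g (Icc 0 1) := by
  have right {h : ℝ → ℝ} (hh : ∀ t ∈ Icc (0:ℝ) 1, HasDerivWithinAt h (f' t) (Icc 0 1) t) :
      ∀ t ∈ Ico (0:ℝ) 1, HasDerivWithinAt h (f' t) (Ici t) t := fun t ht =>
    (hh t (Ico_subset_Icc_self ht)).mono_of_mem_nhdsWithin (Icc_mem_nhdsGE_of_mem ht)
  exact eq_of_has_deriv_right_eq (right hf) (right hg)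
    (fun t ht => (hf t ht).continuousWithinAt) (fun t ht => (hg t ht).continuousWithinAt) h0

lemma hasDerivAt_mul_pow_div (k : ℝ) (n : ℕ) (t : ℝ) :
    HasDerivAt (fun s : ℝ => k * s ^ (n + 1) / (n + 1)) (k * t ^ n) t := by
  refine (((hasDerivAt_pow (n + 1) t).const_mul k).div_const ((n : ℝ) + 1)).congr_deriv ?_
  have : (n : ℝ) + 1 ≠ 0 := by positivity
  simp only [Nat.cast_add, Nat.cast_one, Nat.add_sub_cancel]
  field_simp

/-- A function on `[0,1]` vanishing at `0` with polynomial derivative is the termwise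
antiderivative. -/
lemma eq_sum_of_hasDerivWithinAt_sum {f f' : ℝ → ℝ} (n : ℕ) (k : ℕ → ℝ)
    (hf : ∀ t ∈ Icc (0:ℝ) 1, HasDerivWithinAt f (f' t) (Icc 0 1) t)
    (hf' : ∀ t ∈ Icc (0:ℝ) 1, f' t = ∑ i ∈ Finset.range n, k i * t ^ i)
    (h0 : f 0 = 0) {t : ℝ} (ht : t ∈ Icc (0:ℝ) 1) :
    f t = ∑ i ∈ Finset.range n, k i * t ^ (i + 1) / (i + 1) := by
  refine eqOn_Icc_of_hasDerivWithinAt_eq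
    (g := fun t => ∑ i ∈ Finset.range n, k i * t ^ (i + 1) / (i + 1)) hf (fun s hs => ?_)
    (by simp [h0]) ht
  rw [hf' s hs]
  exact (HasDerivAt.fun_sum fun i _ => hasDerivAt_mul_pow_div (k i) i s).hasDerivWithinAt

/-- The endpoint of an Engel polynomial curve, as an explicit polynomial in the parameters. -/
noncomputable def engelEndpoint (a b : ℝ) (p : Fin 4 → ℝ) : Fin 4 → ℝ :=
  ![a + p 0 / 2,
    b + p 1 / 2 + p 2 / 3 + p 3 / 4,
    b * (a / 2 + p 0 / 6) + p 1 * (a / 3 + p 0 / 8) + p 2 * (a / 4 + p 0 / 10)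
      + p 3 * (a / 5 + p 0 / 12),
    (b * (a ^ 2 / 3 + a * p 0 / 4 + p 0 ^ 2 / 20) + p 1 * (a ^ 2 / 4 + a * p 0 / 5 + p 0 ^ 2 / 24)
      + p 2 * (a ^ 2 / 5 + a * p 0 / 6 + p 0 ^ 2 / 28)
      + p 3 * (a ^ 2 / 6 + a * p 0 / 7 + p 0 ^ 2 / 32)) / 2]

lemma IsEngelPolyCurve.apply_one {a b : ℝ} {p : Fin 4 → ℝ} {γ : ℝ → Fin 4 → ℝ}
    (h : IsEngelPolyCurve a b p γ) : γ 1 = engelEndpoint a b p := by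
  obtain ⟨h0, h⟩ := h
  have one_mem : (1:ℝ) ∈ Icc (0:ℝ) 1 := by simp
  have first : ∀ t ∈ Icc (0:ℝ) 1, γ t 0 = a * t + p 0 * t ^ 2 / 2 := fun t ht => by
    rw [eq_sum_of_hasDerivWithinAt_sum 2 (fun i => [a, p 0].getD i 0) (fun s hs => (h s hs).1)
      (fun s _ => by simp [Finset.sum_range_succ]) (by simp [h0]) ht]
    simp [Finset.sum_range_succ]
    ring
  ext i
  fin_cases i
  · simp [first 1 one_mem, engelEndpoint]
  · change γ 1 1 = _
    rw [eq_sum_of_hasDerivWithinAt_sum 4 (fun i => [b, p 1, p 2, p 3].getD i 0)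
      (fun s hs => (h s hs).2.1) (fun s _ => by simp [Finset.sum_range_succ]) (by simp [h0]) one_mem]
    simp [Finset.sum_range_succ, engelEndpoint]
    ring
  · change γ 1 2 = _
    rw [eq_sum_of_hasDerivWithinAt_sum 6
      (fun i => [0, a * b, a * p 1 + p 0 * b / 2, a * p 2 + p 0 * p 1 / 2,
        a * p 3 + p 0 * p 2 / 2, p 0 * p 3 / 2].getD i 0)
      (fun s hs => (h s hs).2.2.1)
      (fun s hs => by rw [first s hs]; simp [Finset.sum_range_succ]; ring) (by simp [h0]) one_mem]
    simp [Finset.sum_range_succ, engelEndpoint]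
    ring
  · change γ 1 3 = _
    rw [eq_sum_of_hasDerivWithinAt_sum 8
      (fun i => [0, 0, a ^ 2 * b / 2, (a ^ 2 * p 1 + a * p 0 * b) / 2,
        (a ^ 2 * p 2 + a * p 0 * p 1 + p 0 ^ 2 * b / 4) / 2,
        (a ^ 2 * p 3 + a * p 0 * p 2 + p 0 ^ 2 * p 1 / 4) / 2,
        (a * p 0 * p 3 + p 0 ^ 2 * p 2 / 4) / 2, p 0 ^ 2 * p 3 / 8].getD i 0)
      (fun s hs => (h s hs).2.2.2)
      (fun s hs => by rw [first s hs]; simp [Finset.sum_range_succ]; ring) (by simp [h0]) one_mem]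
    simp [Finset.sum_range_succ, engelEndpoint]
    ring

lemma engelEndpoint_zero (a b : ℝ) :
    engelEndpoint a b 0 = ![a, b, a * b / 2, a ^ 2 * b / 6] := by
  ext i
  fin_cases i <;> simp [engelEndpoint] <;> ring

lemma contDiff_engelEndpoint (a b : ℝ) : ContDiff ℝ 1 (engelEndpoint a b) := by
  refine contDiff_pi.2 fun i => ?_
  fin_cases i <;> simp [engelEndpoint] <;> fun_prop

lemma fderiv_engelEndpoint_zero_apply (a b : ℝ) (v : Fin 4 → ℝ) :
    fderiv ℝ (engelEndpoint a b) 0 v =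
      ![v 0 / 2, v 1 / 2 + v 2 / 3 + v 3 / 4,
        b * v 0 / 6 + a * (v 1 / 3 + v 2 / 4 + v 3 / 5),
        a * b * v 0 / 8 + a ^ 2 * (v 1 / 4 + v 2 / 5 + v 3 / 6) / 2] := by
  have hd := ((contDiff_engelEndpoint a b).differentiable one_ne_zero 0).hasFDerivAt
  rw [← (hd.hasLineDerivAt v).lineDeriv, lineDeriv]
  refine (hasDerivAt_pi.2 fun i => ?_).deriv
  have key (k₀ k₁ k₂ k₃ : ℝ) :
      HasDerivAt (fun s : ℝ => k₀ + k₁ * s + k₂ * s ^ 2 + k₃ * s ^ 3) k₁ 0 := by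
    simpa using ((((hasDerivAt_id (0:ℝ)).const_mul k₁).const_add k₀).fun_add
      ((hasDerivAt_pow 2 (0:ℝ)).const_mul k₂)).fun_add ((hasDerivAt_pow 3 (0:ℝ)).const_mul k₃)
  fin_cases i
  · refine (key a (v 0 / 2) 0 0).congr_of_eventuallyEq (.of_forall fun s => ?_)
    simp [engelEndpoint]
    ring
  · refine (key b (v 1 / 2 + v 2 / 3 + v 3 / 4) 0 0).congr_of_eventuallyEq (.of_forall fun s => ?_)
    simp [engelEndpoint]
    ring
  · refine (key (a * b / 2) (b * v 0 / 6 + a * (v 1 / 3 + v 2 / 4 + v 3 / 5))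
      (v 0 * (v 1 / 8 + v 2 / 10 + v 3 / 12)) 0).congr_of_eventuallyEq (.of_forall fun s => ?_)
    simp [engelEndpoint]
    ring
  · refine (key (a ^ 2 * b / 6)
      (a * b * v 0 / 8 + a ^ 2 * (v 1 / 4 + v 2 / 5 + v 3 / 6) / 2)
      (b * v 0 ^ 2 / 40 + a * v 0 * (v 1 / 5 + v 2 / 6 + v 3 / 7) / 2)
      (v 0 ^ 2 * (v 1 / 24 + v 2 / 28 + v 3 / 32) / 2)).congr_of_eventuallyEq (.of_forall fun s => ?_)
    simp [engelEndpoint]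
    ring

lemma surjective_fderiv_engelEndpoint_zero {a : ℝ} (b : ℝ) (ha : a ≠ 0) :
    Function.Surjective (fderiv ℝ (engelEndpoint a b) 0) := by
  intro w
  obtain ⟨u, hu⟩ : ∃ u, w 2 = b * w 0 / 3 + a * u :=
    ⟨(w 2 - b * w 0 / 3) / a, by field_simp; ring⟩
  obtain ⟨x, hx⟩ : ∃ x, w 3 = a * b * w 0 / 4 + a ^ 2 * x / 2 :=
    ⟨2 * (w 3 - a * b * w 0 / 4) / a ^ 2, by field_simp; ring⟩
  refine ⟨![2 * w 0, 72 * w 1 - 240 * u + 180 * x, -240 * w 1 + 900 * u - 720 * x,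
    180 * w 1 - 720 * u + 600 * x], ?_⟩
  rw [fderiv_engelEndpoint_zero_apply]
  ext i
  fin_cases i <;> simp [hu, hx] <;> ring

/-- For `a ≠ 0`, the endpoint map `F(p) = γ_p(1)` maps every Euclidean ball
`B(0,r)` onto a neighborhood of `F(0) = (a, b, ab/2, a²b/6)`. -/
theorem engel_endpoint_map_open (a b : ℝ) (ha : a ≠ 0)
    (γ : (Fin 4 → ℝ) → ℝ → Fin 4 → ℝ)
    (hγ : ∀ p, IsEngelPolyCurve a b p (γ p)) :
    γ 0 1 = ![a, b, a * b / 2, a^2 * b / 6] ∧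
    ∀ r > 0,
      (fun p => γ p 1) '' {p : Fin 4 → ℝ | Real.sqrt (∑ i, (p i)^2) < r} ∈
        nhds (![a, b, a * b / 2, a^2 * b / 6] : Fin 4 → ℝ) := by
  have endpoint : (fun p => γ p 1) = engelEndpoint a b := funext fun p => (hγ p).apply_one
  refine ⟨(congrFun endpoint 0).trans (engelEndpoint_zero a b), fun r hr => ?_⟩
  have ball_mem : {p : Fin 4 → ℝ | Real.sqrt (∑ i, (p i)^2) < r} ∈ nhds 0 :=
    (isOpen_lt (by fun_prop) continuous_const).mem_nhds (by simpa using hr)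
  have strict := (contDiff_engelEndpoint a b).contDiffAt.hasStrictFDerivAt (x := 0) one_ne_zero
  rw [endpoint, ← engelEndpoint_zero, ← strict.map_nhds_eq_of_surj
    (LinearMap.range_eq_top.2 (surjective_fderiv_engelEndpoint_zero b ha))]
  exact Filter.image_mem_map ball_mem
end

section
/- Let F : [a,b] → ℝ be absolutely continuous and nondecreasing, and let D ⊂ ℝ be a set of Lebesgue measure zero. Then the set {t ∈ [a,b] : F is differentiable at t, F'(t) > 0, and F(t) ∈ D} has Lebesgue measure zero. -/
open MeasureTheory Set

/-- If `F` is absolutely continuous and nondecreasing on `[a,b]` and `D` is a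
Lebesgue null set, then the set of points `t` where `F` is differentiable with
`F'(t) > 0` and `F(t) ∈ D` is Lebesgue null. -/
theorem null_preimage_of_positive_derivative (a b : ℝ) (F : ℝ → ℝ)
    (hAC : AbsCont F a b) (hmono : MonotoneOn F (Icc a b))
    (D : Set ℝ) (hD : volume D = 0) :
    volume {t ∈ Icc a b |
      DifferentiableAt ℝ F t ∧ 0 < deriv F t ∧ F t ∈ D} = 0 := by
  set E := {t : ℝ | DifferentiableAt ℝ F t}
  have hE : MeasurableSet E := measurableSet_of_differentiableAt ℝ F
  have hE_preimage : MeasurableSet (E ∩ F ⁻¹' toMeasurable volume D) := by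
    have hF : ContinuousOn F E := fun t ht ↦ ht.continuousAt.continuousWithinAt
    rw [← Subtype.image_preimage_coe]
    exact hE.subtype_image (hF.domRestrict.measurable (measurableSet_toMeasurable volume D))
  set S := Icc a b ∩ (E ∩ F ⁻¹' toMeasurable volume D) ∩ {t | 0 < deriv F t}
  have hS : MeasurableSet S :=
    (measurableSet_Icc.inter hE_preimage).inter
      (measurableSet_lt measurable_const (measurable_deriv F))
  have h_integral : ∫⁻ t in S, ENNReal.ofReal (deriv F t) = 0 := by
    rw [lintegral_deriv_eq_volume_image_of_monotoneOn hS
      (fun t ht ↦ ht.1.2.1.hasDerivAt.hasDerivWithinAt)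
      (hmono.mono fun t ht ↦ ht.1.1)]
    refine measure_mono_null ?_ ((measure_toMeasurable D).trans hD)
    rintro _ ⟨t, ht, rfl⟩
    exact ht.1.2.2
  have hS_null : volume S = 0 := by
    by_contra h
    refine ((setLIntegral_pos_iff (measurable_deriv F).ennreal_ofReal).2 ?_).ne' h_integral
    have h_support : S ⊆ Function.support fun t ↦ ENNReal.ofReal (deriv F t) :=
      fun t ht ↦ (ENNReal.ofReal_pos.2 ht.2).ne'
    rw [inter_eq_right.2 h_support]
    exact pos_iff_ne_zero.2 h
  refine measure_mono_null ?_ hS_null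
  rintro t ⟨htab, hdiff, hpos, htD⟩
  exact ⟨⟨htab, hdiff, subset_toMeasurable volume D htD⟩, hpos⟩
end
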